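/- arXiv:2202.07337 — 10 statements merged into one kernel-verified Lean document; each statement's English description precedes it below -/
import Mathlib

section
/- The class of metric spaces is complete with respect to the Gromov–Hausdorff distance: for every sequence (X_n) of nonempty metric spaces which is Cauchy in the Gromov–Hausdorff distance (i.e., for every ε > 0 there exists N such that dGH(X_m, X_n) ≤ ε for all m, n ≥ N), there exists a nonempty metric space X such that dGH(X_n, X) → 0 as n → ∞. -/
set_option linter.unusedVariables false
set_option linter.unreachableTactic false
set_option linter.unusedTactic false

open scoped ENNReal

/-- A correspondence between `X` and `Y`: a relation such that every point of `X`
is related to some point of `Y` and vice versa. -/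
def IsCorrespondence {X Y : Type*} (R : Set (X × Y)) : Prop :=
  (∀ x : X, ∃ y : Y, (x, y) ∈ R) ∧ (∀ y : Y, ∃ x : X, (x, y) ∈ R)

/-- The distortion of a relation `R ⊆ X × Y`:
`sup {|dist x x' - dist y y'| : (x,y), (x',y') ∈ R}`, in `[0,∞]`. -/
noncomputable def distortion {X Y : Type*} [MetricSpace X] [MetricSpace Y]
    (R : Set (X × Y)) : ℝ≥0∞ :=
  ⨆ p ∈ R, ⨆ q ∈ R, ENNReal.ofReal |dist p.1 q.1 - dist p.2 q.2|

/-- The Gromov–Hausdorff distance between two metric spaces: half the infimum of the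
distortions of all correspondences between them, in `[0,∞]`. -/
noncomputable def GHDist (X Y : Type*) [MetricSpace X] [MetricSpace Y] : ℝ≥0∞ :=
  (⨅ R : {R : Set (X × Y) // IsCorrespondence R}, distortion R.1) / 2

universe u

theorem exists_correspondence_of_GHDist_lt {X Y : Type*} [MetricSpace X] [MetricSpace Y] {ε : ℝ}
    (h : GHDist X Y < ENNReal.ofReal ε) :
    ∃ R : Set (X × Y), IsCorrespondence R ∧
      ∀ p ∈ R, ∀ q ∈ R, |dist p.1 q.1 - dist p.2 q.2| ≤ 2 * ε := by
  have hε : 0 < ε := ENNReal.ofReal_pos.1 (bot_le.trans_lt h)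
  rw [GHDist, ENNReal.div_lt_iff (by simp) (by simp), iInf_lt_iff] at h
  obtain ⟨⟨R, hR⟩, h⟩ := h
  refine ⟨R, hR, fun p hp q hq => ?_⟩
  have hle : ENNReal.ofReal |dist p.1 q.1 - dist p.2 q.2| ≤ distortion R :=
    le_iSup₂_of_le p hp (le_iSup₂_of_le q hq le_rfl)
  have h2 : ENNReal.ofReal ε * 2 = ENNReal.ofReal (2 * ε) := by
    rw [mul_comm, ENNReal.ofReal_mul (by norm_num), ENNReal.ofReal_ofNat]
  rw [h2] at h
  exact (ENNReal.ofReal_le_ofReal_iff (by positivity)).1 (hle.trans h.le)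

theorem GHDist_le_of_correspondence {X Y : Type*} [MetricSpace X] [MetricSpace Y] {δ : ℝ}
    {R : Set (X × Y)} (hR : IsCorrespondence R)
    (h : ∀ p ∈ R, ∀ q ∈ R, |dist p.1 q.1 - dist p.2 q.2| ≤ δ) :
    GHDist X Y ≤ ENNReal.ofReal δ := by
  refine ENNReal.half_le_self.trans' (ENNReal.div_le_div_right ?_ 2)
  refine (iInf_le _ ⟨R, hR⟩).trans ?_
  exact iSup₂_le fun p hp => iSup₂_le fun q hq => ENNReal.ofReal_le_ofReal (h p hp q hq)

/-- Every point of a sequence of types linked by bitotal relations lies on a thread. -/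
theorem exists_thread (k : ℕ) : ∀ (Y : ℕ → Type u) (R : ∀ n, Set (Y n × Y (n + 1)))
    (_ : ∀ n, IsCorrespondence (R n)) (x : Y k),
    ∃ t : ∀ n, Y n, (∀ n, (t n, t (n + 1)) ∈ R n) ∧ t k = x := by
  induction k with
  | zero =>
    intro Y R hR x
    choose f hf using fun n => (hR n).1
    exact ⟨fun n => Nat.rec x (fun n y => f n y) n, fun n => hf n _, rfl⟩
  | succ k ih =>
    intro Y R hR x
    obtain ⟨t, ht, hx⟩ := ih (fun n => Y (n + 1)) (fun n => R (n + 1)) (fun n => hR (n + 1)) x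
    obtain ⟨y, hy⟩ := (hR 0).2 (t 0)
    refine ⟨fun n => Nat.casesOn n y t, fun n => ?_, hx⟩
    cases n with
    | zero => exact hy
    | succ n => exact ht n

/-- The threads of a sequence of types linked by relations. -/
def Thread {Y : ℕ → Type u} (R : ∀ n, Set (Y n × Y (n + 1))) : Type u :=
  {t : ∀ n, Y n // ∀ n, (t n, t (n + 1)) ∈ R n}

/-- A sequence of metric spaces linked by correspondences of geometrically decaying distortion
has a limit, the metric quotient of the space of threads. -/
theorem exists_limit_of_correspondences (Y : ℕ → Type u) [∀ n, MetricSpace (Y n)]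
    [Nonempty (Y 0)] (R : ∀ n, Set (Y n × Y (n + 1))) (hR : ∀ n, IsCorrespondence (R n))
    (hd : ∀ n, ∀ p ∈ R n, ∀ q ∈ R n, |dist p.1 q.1 - dist p.2 q.2| ≤ 2 / 2 / 2 ^ n) :
    ∃ (Z : Type u) (_ : MetricSpace Z), Nonempty Z ∧ ∀ k, ∃ S : Set (Y k × Z),
      IsCorrespondence S ∧ ∀ p ∈ S, ∀ q ∈ S, |dist p.1 q.1 - dist p.2 q.2| ≤ 2 / 2 ^ k := by
  have hstep (s t : Thread R) (n : ℕ) :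
      dist (dist (s.1 n) (t.1 n)) (dist (s.1 (n + 1)) (t.1 (n + 1))) ≤ 2 / 2 / 2 ^ n :=
    hd n _ (s.2 n) _ (t.2 n)
  have hlim (s t : Thread R) :
      ∃ a, Filter.Tendsto (fun n => dist (s.1 n) (t.1 n)) Filter.atTop (nhds a) :=
    cauchySeq_tendsto_of_complete (cauchySeq_of_le_geometric_two (hstep s t))
  choose D hD using hlim
  let instT : PseudoMetricSpace (Thread R) :=
    { dist := D
      dist_self := fun s => tendsto_nhds_unique (hD s s) (by simp)
      dist_comm := fun s t => tendsto_nhds_unique (hD s t) (by simpa [dist_comm] using hD t s)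
      dist_triangle := fun s t r => le_of_tendsto_of_tendsto' (hD s r) ((hD s t).add (hD t r))
        fun n => dist_triangle _ _ _ }
  refine ⟨SeparationQuotient (Thread R), inferInstance, ?_, fun k => ?_⟩
  · obtain ⟨t, ht, -⟩ := exists_thread 0 Y R hR (Classical.arbitrary _)
    exact ⟨SeparationQuotient.mk (⟨t, ht⟩ : Thread R)⟩
  · refine ⟨Set.range fun t : Thread R => (t.1 k, SeparationQuotient.mk t),
      ⟨fun x => ?_, fun z => ?_⟩, ?_⟩
    · obtain ⟨t, ht, rfl⟩ := exists_thread k Y R hR x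
      exact ⟨SeparationQuotient.mk (⟨t, ht⟩ : Thread R), ⟨t, ht⟩, rfl⟩
    · obtain ⟨t, rfl⟩ := SeparationQuotient.surjective_mk z
      exact ⟨t.1 k, t, rfl⟩
    · rintro _ ⟨s, rfl⟩ _ ⟨t, rfl⟩
      exact dist_le_of_le_geometric_two_of_tendsto (hstep s t) (hD s t) k

theorem IsCorrespondence.exists_comp {X Y Z : Type*} [MetricSpace X] [MetricSpace Y]
    [MetricSpace Z] {R : Set (X × Y)} {S : Set (Y × Z)} (hR : IsCorrespondence R)
    (hS : IsCorrespondence S) {a b : ℝ}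
    (ha : ∀ p ∈ R, ∀ q ∈ R, |dist p.1 q.1 - dist p.2 q.2| ≤ a)
    (hb : ∀ p ∈ S, ∀ q ∈ S, |dist p.1 q.1 - dist p.2 q.2| ≤ b) :
    ∃ Q : Set (X × Z), IsCorrespondence Q ∧
      ∀ p ∈ Q, ∀ q ∈ Q, |dist p.1 q.1 - dist p.2 q.2| ≤ a + b := by
  refine ⟨{p | ∃ y, (p.1, y) ∈ R ∧ (y, p.2) ∈ S}, ⟨fun x => ?_, fun z => ?_⟩, ?_⟩
  · obtain ⟨y, hy⟩ := hR.1 x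
    obtain ⟨z, hz⟩ := hS.1 y
    exact ⟨z, y, hy, hz⟩
  · obtain ⟨y, hy⟩ := hS.2 z
    obtain ⟨x, hx⟩ := hR.2 y
    exact ⟨x, y, hx, hy⟩
  · rintro p ⟨y, hpy, hyp⟩ q ⟨y', hqy, hyq⟩
    exact (abs_sub_le _ (dist y y') _).trans
      (add_le_add (ha _ hpy _ hqy) (hb _ hyp _ hyq))

/-- The class of metric spaces is complete in the Gromov–Hausdorff distance: every
sequence of nonempty metric spaces which is Cauchy in `GHDist` converges to some
nonempty metric space. -/
theorem gromovHausdorff_class_complete (X : ℕ → Type u) (m : ∀ n, MetricSpace (X n))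
    (hne : ∀ n, Nonempty (X n))
    (hcauchy : ∀ ε : ℝ, 0 < ε → ∃ N : ℕ, ∀ j k : ℕ, N ≤ j → N ≤ k →
      @GHDist (X j) (X k) (m j) (m k) ≤ ENNReal.ofReal ε) :
    ∃ (Z : Type u) (mZ : MetricSpace Z), Nonempty Z ∧
      Filter.Tendsto (fun n => @GHDist (X n) Z (m n) mZ) Filter.atTop (nhds 0) := by
  have hcorr (ε : ℝ) (hε : 0 < ε) : ∃ N : ℕ, ∀ j k : ℕ, N ≤ j → N ≤ k →
      ∃ R : Set (X j × X k), IsCorrespondence R ∧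
        ∀ p ∈ R, ∀ q ∈ R, |dist p.1 q.1 - dist p.2 q.2| ≤ ε := by
    obtain ⟨N, hN⟩ := hcauchy (ε / 4) (by positivity)
    refine ⟨N, fun j k hj hk => ?_⟩
    have hlt : GHDist (X j) (X k) < ENNReal.ofReal (ε / 2) :=
      (hN j k hj hk).trans_lt ((ENNReal.ofReal_lt_ofReal_iff (by positivity)).2 (by linarith))
    simpa [mul_div_cancel₀] using exists_correspondence_of_GHDist_lt hlt
  choose N hN using fun n : ℕ => hcorr (2 / 2 / 2 ^ n) (by positivity)
  let φ : ℕ → ℕ := fun n => ∑ i ∈ Finset.range (n + 1), N i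
  have hφ (n : ℕ) : N n ≤ φ n :=
    Finset.single_le_sum (f := N) (fun i _ => Nat.zero_le _) (Finset.self_mem_range_succ n)
  have hφ' (n : ℕ) : φ n ≤ φ (n + 1) := by
    simp only [φ, Finset.sum_range_succ _ (n + 1)]
    omega
  choose R hR hd using fun n => hN n (φ n) (φ (n + 1)) (hφ n) ((hφ n).trans (hφ' n))
  obtain ⟨Z, mZ, hZ, hS⟩ := exists_limit_of_correspondences (fun n => X (φ n)) R hR hd
  refine ⟨Z, mZ, hZ, ENNReal.tendsto_nhds_zero.2 fun ε hε => ?_⟩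
  have hpow : Filter.Tendsto (fun k : ℕ => ENNReal.ofReal (2 / 2 / 2 ^ k + 2 / 2 ^ k))
      Filter.atTop (nhds 0) := by
    have h (c : ℝ) : Filter.Tendsto (fun k : ℕ => c / 2 ^ k) Filter.atTop (nhds 0) :=
      tendsto_const_nhds.div_atTop (tendsto_pow_atTop_atTop_of_one_lt one_lt_two)
    simpa using ENNReal.tendsto_ofReal ((h (2 / 2)).add (h 2))
  obtain ⟨k, hk⟩ := (ENNReal.tendsto_nhds_zero.1 hpow ε hε).exists
  obtain ⟨S, hS, hSd⟩ := hS k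
  filter_upwards [Filter.eventually_ge_atTop (N k)] with n hn
  obtain ⟨Q, hQ, hQd⟩ := hN k n (φ k) hn (hφ k)
  obtain ⟨P, hP, hPd⟩ := hQ.exists_comp hS hQd hSd
  exact (GHDist_le_of_correspondence hP hPd).trans hk
end

section
/- Let X and Y be nonempty metric spaces and let R be a correspondence between X and Y with 0 < dis R < ∞. Define a symmetric distance on the disjoint union X ⊔ Y extending the metrics of X and Y by setting, for x ∈ X and y ∈ Y, |xy| = inf{ dist(x,x') + dist(y,y') + (dis R)/2 : (x',y') ∈ R }. Then this distance is a metric on X ⊔ Y, and the Hausdorff distance between the copies of X and Y inside this metric space equals (dis R)/2. -/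
set_option linter.unusedVariables false
set_option linter.unreachableTactic false
set_option linter.unusedTactic false

open scoped ENNReal

/-- The distance function of an explicitly given metric-space structure. -/
noncomputable def mdist {Z : Type*} (mZ : MetricSpace Z) (a b : Z) : ℝ :=
  @dist Z mZ.toPseudoMetricSpace.toDist a b

/-- If every point of `s` and of `t` has a point of the other set within distance `r`, and all
distances between points of `s` and points of `t` are at least `r`, then the Hausdorff distance
between `s` and `t` is `r`. -/
theorem Metric.hausdorffDist_eq_of_forall_le_dist {Z : Type*} [PseudoMetricSpace Z] {s t : Set Z}
    {r : ℝ} (hs : s.Nonempty) (hr : 0 ≤ r) (hst : ∀ a ∈ s, ∃ b ∈ t, dist a b ≤ r)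
    (hts : ∀ b ∈ t, ∃ a ∈ s, dist b a ≤ r) (hle : ∀ a ∈ s, ∀ b ∈ t, r ≤ dist a b) :
    hausdorffDist s t = r := by
  refine le_antisymm (hausdorffDist_le_of_mem_dist hr hst hts) (le_of_forall_gt fun c hc ↦ ?_)
  obtain ⟨a, ha⟩ := hs
  have htop : hausdorffEDist s t ≠ ⊤ := by
    refine ne_top_of_le_ne_top (ENNReal.ofReal_ne_top (r := r))
      (hausdorffEDist_le_of_mem_edist (fun x hx ↦ ?_) fun x hx ↦ ?_)
    · obtain ⟨y, hy, h⟩ := hst x hx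
      exact ⟨y, hy, (edist_le_ofReal hr).2 h⟩
    · obtain ⟨y, hy, h⟩ := hts x hx
      exact ⟨y, hy, (edist_le_ofReal hr).2 h⟩
  obtain ⟨b, hb, h⟩ := exists_dist_lt_of_hausdorffDist_lt ha hc htop
  exact (hle a ha b hb).trans_lt h

/-- Any two related pairs distort the distance by at most the distortion of the relation. -/
theorem abs_dist_sub_dist_le_distortion {X Y : Type*} [MetricSpace X] [MetricSpace Y]
    {R : Set (X × Y)} (hfin : distortion R ≠ ⊤) {p q : X × Y} (hp : p ∈ R) (hq : q ∈ R) :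
    |dist p.1 q.1 - dist p.2 q.2| ≤ (distortion R).toReal :=
  (ENNReal.ofReal_le_iff_le_toReal hfin).1 <|
    (le_iSup₂ (f := fun q (_ : q ∈ R) ↦
      ENNReal.ofReal |dist p.1 q.1 - dist p.2 q.2|) q hq).trans
      (le_iSup₂ (f := fun p (_ : p ∈ R) ↦ ⨆ q ∈ R,
        ENNReal.ofReal |dist p.1 q.1 - dist p.2 q.2|) p hp)

/-- Gluing two metric spaces along a correspondence `R` with `0 < dis R < ∞`:
the explicit distance on `X ⊔ Y` is a metric, and the Hausdorff distance between the
copies of `X` and `Y` equals `(dis R)/2`. -/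
theorem glue_metric_of_correspondence {X Y : Type*} [MetricSpace X] [MetricSpace Y]
    [Nonempty X] [Nonempty Y] (R : Set (X × Y)) (hR : IsCorrespondence R)
    (hpos : 0 < distortion R) (hfin : distortion R ≠ ⊤) :
    ∃ mZ : MetricSpace (X ⊕ Y),
      (∀ x x' : X, mdist mZ (Sum.inl x) (Sum.inl x') = dist x x') ∧
      (∀ y y' : Y, mdist mZ (Sum.inr y) (Sum.inr y') = dist y y') ∧
      (∀ (x : X) (y : Y), mdist mZ (Sum.inl x) (Sum.inr y) =
        ⨅ p : R, (dist x p.1.1 + dist y p.1.2 + (distortion R).toReal / 2)) ∧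
      @Metric.hausdorffDist (X ⊕ Y) mZ.toPseudoMetricSpace
        (Set.range Sum.inl) (Set.range Sum.inr) = (distortion R).toReal / 2 := by
  obtain ⟨x₀⟩ := ‹Nonempty X›
  obtain ⟨y₀, h₀⟩ := hR.1 x₀
  have : Nonempty R := ⟨⟨_, h₀⟩⟩
  have hε : 0 < (distortion R).toReal / 2 := half_pos (ENNReal.toReal_pos hpos.ne' hfin)
  let Φ : R → X := fun p ↦ p.1.1
  let Ψ : R → Y := fun p ↦ p.1.2
  let mZ : MetricSpace (X ⊕ Y) := Metric.glueMetricApprox Φ Ψ _ hε fun p q ↦ by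
    rw [mul_div_cancel₀ _ two_ne_zero]
    exact abs_dist_sub_dist_le_distortion hfin p.2 q.2
  have hglued {x : X} {y : Y} (h : (x, y) ∈ R) :
      dist (Sum.inl x : X ⊕ Y) (Sum.inr y) = (distortion R).toReal / 2 :=
    Metric.glueDist_glued_points Φ Ψ _ ⟨(x, y), h⟩
  refine ⟨mZ, fun _ _ ↦ rfl, fun _ _ ↦ rfl, fun x y ↦ ?_, ?_⟩
  · exact ciInf_add ⟨0, by rintro _ ⟨p, rfl⟩; positivity⟩ _
  · refine Metric.hausdorffDist_eq_of_forall_le_dist ⟨_, x₀, rfl⟩ hε.le ?_ ?_ ?_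
    · rintro _ ⟨x, rfl⟩
      obtain ⟨y, h⟩ := hR.1 x
      exact ⟨_, ⟨y, rfl⟩, (hglued h).le⟩
    · rintro _ ⟨y, rfl⟩
      obtain ⟨x, h⟩ := hR.2 y
      exact ⟨_, ⟨x, rfl⟩, by rw [dist_comm]; exact (hglued h).le⟩
    · rintro _ ⟨x, rfl⟩ _ ⟨y, rfl⟩
      exact Metric.le_glueDist_inl_inr Φ Ψ _ x y
end

section
/- For nonempty subsets X, Y ⊆ (0,∞), the hedgehogs X̂ and Ŷ are isometric if and only if X = Y. -/
set_option linter.unusedVariables false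
set_option linter.unreachableTactic false
set_option linter.unusedTactic false

/-- Two (explicitly given) metric-space structures are isometric: there is a
distance-preserving bijection between them. -/
def IsometricM {X Y : Type*} (mX : MetricSpace X) (mY : MetricSpace Y) : Prop :=
  ∃ f : X ≃ Y, ∀ a b : X,
    @dist Y mY.toPseudoMetricSpace.toDist (f a) (f b) =
      @dist X mX.toPseudoMetricSpace.toDist a b

open Classical in
/-- The hedgehog distance on `Option A` for a needle-length function `f : A → ℝ`:
the distance between distinct needle tips `a, b` is `f a + f b`, and the distance
from the center `none` to a needle tip `a` is `f a`. -/
noncomputable def hedgehogDist {A : Type*} (f : A → ℝ) : Option A → Option A → ℝ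
  | none, none => 0
  | none, some a => f a
  | some a, none => f a
  | some a, some b => if a = b then 0 else f a + f b

/-- The hedgehog over `(A, f)` (a hedgehog over a set of needle lengths with
multiplicities): the metric space on `A ∪ {0}` (encoded as `Option A`) with the
hedgehog distance. -/
noncomputable def hedgehog {A : Type*} (f : A → ℝ) (hf : ∀ a, 0 < f a) :
    MetricSpace (Option A) :=
  { dist := hedgehogDist f
    dist_self := fun a => by
      cases a with
      | none => rfl
      | some a => simp [hedgehogDist]
    dist_comm := fun a b => by
      cases a <;> cases b <;> simp only [hedgehogDist]
      rename_i a b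
      by_cases h : a = b
      · simp [h]
      · rw [if_neg h, if_neg (Ne.symm h), add_comm]
    dist_triangle := fun x y z => by
      rcases x with _ | a <;> rcases y with _ | b <;> rcases z with _ | c <;>
        simp only [hedgehogDist]
      · linarith
      · linarith [(hf c).le]
      · linarith [(hf b).le]
      · have pb := (hf b).le; have pc := (hf c).le
        split_ifs <;> try subst_vars
        all_goals first | linarith | simp_all
      · linarith
      · have pa := (hf a).le; have pc := (hf c).le
        split_ifs <;> try subst_vars
        all_goals first | linarith | simp_all
      · have pa := (hf a).le; have pb := (hf b).le
        split_ifs <;> try subst_vars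
        all_goals first | linarith | simp_all
      · have pa := (hf a).le; have pb := (hf b).le; have pc := (hf c).le
        split_ifs <;> try subst_vars
        all_goals first | linarith | simp_all
    eq_of_dist_eq_zero := fun {a b} h0 => by
      rcases a with _ | a <;> rcases b with _ | b <;> simp only [hedgehogDist] at h0 ⊢
      · exact absurd h0 (hf _).ne'
      · exact absurd h0 (hf _).ne'
      · by_cases h : a = b
        · simp [h]
        · rw [if_neg h] at h0
          have := hf a; have := hf b
          exact absurd h0 (by linarith) }

/-- The hedgehog over a set `X ⊆ (0,∞)` of needle lengths. -/
noncomputable def hedgehogSet (X : Set ℝ) (hX : X ⊆ Set.Ioi 0) :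
    MetricSpace (Option ↥X) :=
  hedgehog (fun x : X => (x : ℝ)) (fun x => hX x.2)

/-- If a distance-preserving bijection exists, every needle length of the first hedgehog is a
needle length of the second. -/
theorem range_subset_range_of_hedgehogDist_eq {A B : Type*} {f : A → ℝ} {g : B → ℝ}
    (hf : ∀ a, 0 < f a) (hg : ∀ b, 0 < g b) (e : Option A ≃ Option B)
    (he : ∀ a b, hedgehogDist g (e a) (e b) = hedgehogDist f a b) :
    Set.range f ⊆ Set.range g := by
  rintro _ ⟨a, rfl⟩
  have hne : e (some a) ≠ e none := e.injective.ne (by simp)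
  have ha := he none (some a)
  rcases h0 : e none with _ | b <;> rcases h1 : e (some a) with _ | c <;>
    simp only [h0, h1, hedgehogDist] at ha
  · exact absurd (h1.trans h0.symm) hne
  · exact ⟨c, ha⟩
  · exact ⟨b, ha⟩
  · exfalso
    have hbc : b ≠ c := by
      rintro rfl
      exact hne (h1.trans h0.symm)
    rw [if_neg hbc] at ha
    obtain ⟨p, hp⟩ := e.surjective none
    rcases p with _ | a'
    · simp [h0] at hp
    have haa' : a ≠ a' := by
      rintro rfl
      simp [h1] at hp
    have h2 := he none (some a')
    have h3 := he (some a) (some a')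
    simp only [h0, h1, hp, hedgehogDist, if_neg haa'] at h2 h3
    linarith [hg b]

/-- Isometric hedgehogs have the same set of needle lengths. -/
theorem range_eq_range_of_isometricM_hedgehog {A B : Type*} {f : A → ℝ} {g : B → ℝ}
    {hf : ∀ a, 0 < f a} {hg : ∀ b, 0 < g b} (h : IsometricM (hedgehog f hf) (hedgehog g hg)) :
    Set.range f = Set.range g := by
  obtain ⟨e, he⟩ := h
  change ∀ a b, hedgehogDist g (e a) (e b) = hedgehogDist f a b at he
  refine (range_subset_range_of_hedgehogDist_eq hf hg e he).antisymm
    (range_subset_range_of_hedgehogDist_eq hg hf e.symm fun a b => ?_)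
  simpa using (he (e.symm a) (e.symm b)).symm

/-- Two hedgehogs over nonempty subsets of `(0,∞)` are isometric iff the subsets
coincide. -/
theorem hedgehog_isometric_iff_eq (X Y : Set ℝ) (hX : X ⊆ Set.Ioi 0) (hY : Y ⊆ Set.Ioi 0)
    (hXne : X.Nonempty) (hYne : Y.Nonempty) :
    IsometricM (hedgehogSet X hX) (hedgehogSet Y hY) ↔ X = Y := by
  constructor
  · intro h
    simpa using range_eq_range_of_isometricM_hedgehog h
  · rintro rfl
    exact ⟨Equiv.refl _, fun _ _ => rfl⟩
end

section
/- For a nonempty subset X ⊆ (0,∞), the following are equivalent: (1) for every λ > 0 the hedgehog over the set λX = {λx : x ∈ X} is isometric to the hedgehog X̂; (2) X = (0,∞). -/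
set_option linter.unusedVariables false
set_option linter.unreachableTactic false
set_option linter.unusedTactic false

lemma scaled_subset {X : Set ℝ} (hX : X ⊆ Set.Ioi 0) {lam : ℝ} (hlam : 0 < lam) :
    (fun x => lam * x) '' X ⊆ Set.Ioi 0 := by
  rintro y ⟨x, hx, rfl⟩
  exact mul_pos hlam (hX hx)

/-- A distance-preserving bijection between hedgehogs over sets `X` and `Y` forces every needle
length of `X` to be a needle length of `Y`. -/
lemma subset_of_isometricM_hedgehogSet {X Y : Set ℝ} {hX : X ⊆ Set.Ioi 0} {hY : Y ⊆ Set.Ioi 0}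
    (h : IsometricM (hedgehogSet X hX) (hedgehogSet Y hY)) : X ⊆ Y := by
  obtain ⟨f, hf⟩ := h
  replace hf : ∀ a b, hedgehogDist (fun y : Y => (y : ℝ)) (f a) (f b) =
      hedgehogDist (fun x : X => (x : ℝ)) a b := hf
  intro x hx
  have hx_pos : 0 < x := hX hx
  have hcx := hf none (some ⟨x, hx⟩)
  rcases hc : f none with _ | p
  · rcases hfx : f (some ⟨x, hx⟩) with _ | q
    · simp [hedgehogDist, hc, hfx] at hcx
      linarith
    · simp [hedgehogDist, hc, hfx] at hcx
      exact hcx ▸ q.2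
  · rcases hfx : f (some ⟨x, hx⟩) with _ | q
    · simp [hedgehogDist, hc, hfx] at hcx
      exact hcx ▸ p.2
    · obtain ⟨a, ha⟩ := f.surjective none
      rcases a with _ | a
      · simp [hc] at ha
      have hpq : p ≠ q := by
        rintro rfl
        simpa using f.injective (hc.trans hfx.symm)
      have hax : a ≠ ⟨x, hx⟩ := by
        rintro rfl
        simp [hfx] at ha
      have hca := hf none (some a)
      have hax_dist := hf (some a) (some ⟨x, hx⟩)
      simp [hedgehogDist, hc, hfx, hpq] at hcx
      simp [hedgehogDist, hc, ha] at hca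
      simp [hedgehogDist, ha, hfx, hax] at hax_dist
      have ha_pos : 0 < (a : ℝ) := hX a.2
      linarith

lemma isometricM_hedgehogSet_of_eq {X Y : Set ℝ} {hX : X ⊆ Set.Ioi 0} {hY : Y ⊆ Set.Ioi 0}
    (h : X = Y) : IsometricM (hedgehogSet X hX) (hedgehogSet Y hY) := by
  subst h
  exact ⟨Equiv.refl _, fun _ _ => rfl⟩

/-- The hedgehog over `λX` is isometric to the hedgehog over `X` for every `λ > 0`
iff `X = (0,∞)`. -/
theorem hedgehog_scale_isometric_iff (X : Set ℝ) (hX : X ⊆ Set.Ioi 0) (hXne : X.Nonempty) :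
    (∀ (lam : ℝ) (hlam : 0 < lam),
      IsometricM (hedgehogSet ((fun x => lam * x) '' X) (scaled_subset hX hlam))
        (hedgehogSet X hX)) ↔ X = Set.Ioi 0 := by
  constructor
  · intro h
    obtain ⟨x, hx⟩ := hXne
    have hx_pos : 0 < x := hX hx
    refine hX.antisymm fun y hy => ?_
    exact subset_of_isometricM_hedgehogSet (h (y / x) (div_pos hy hx_pos))
      ⟨x, hx, div_mul_cancel₀ y hx_pos.ne'⟩
  · rintro rfl lam hlam
    refine isometricM_hedgehogSet_of_eq ((scaled_subset hX hlam).antisymm fun y hy => ?_)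
    exact ⟨y / lam, div_pos hy hlam, mul_div_cancel₀ y hlam.ne'⟩
end

section
/- Let X, Y ⊆ (0,∞) be nonempty subsets, M > 0, and suppose X ∩ [2M, ∞) contains at least two elements. Let Z be a metric space containing isometric copies of the hedgehogs X̂ and Ŷ, with centers 0_X and 0_Y and needle-tip sets X and Y respectively, and suppose every point of the copy of X̂ lies within distance strictly less than M of some point of the copy of Ŷ. Then dist(0_X, 0_Y) < 4M in Z, and every needle tip x ∈ X with x ≥ 5M lies within distance strictly less than M of some needle tip y ∈ Y (not merely of the center 0_Y). -/
set_option linter.unusedVariables false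
set_option linter.unreachableTactic false
set_option linter.unusedTactic false

/-- Points close to two given points are nearly as far apart as those. -/
theorem abs_dist_sub_dist_lt_two_mul {Z : Type*} [PseudoMetricSpace Z] {a b a' b' : Z} {M : ℝ}
    (ha : dist a a' < M) (hb : dist b b' < M) : |dist a b - dist a' b'| < 2 * M := by
  rw [← Real.dist_eq]
  linarith [dist_dist_dist_le a b a' b']

/-- If copies of the hedgehogs over `X` and `Y` sit in a metric space `Z` with the
copy of the hedgehog over `X` inside the open `M`-neighborhood of the copy of the
hedgehog over `Y`, and `X ∩ [2M,∞)` has at least two points, then the centers are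
at distance `< 4M`, and every needle tip of `X` of length `≥ 5M` is within distance
`< M` of some needle tip of `Y`. -/
theorem hedgehog_neighborhood_centers {Z : Type*} [MetricSpace Z]
    (X Y : Set ℝ) (hX : X ⊆ Set.Ioi 0) (hY : Y ⊆ Set.Ioi 0)
    (hXne : X.Nonempty) (hYne : Y.Nonempty) (M : ℝ) (hM : 0 < M)
    (htwo : ∃ x₁ ∈ X, ∃ x₂ ∈ X, x₁ ≠ x₂ ∧ 2 * M ≤ x₁ ∧ 2 * M ≤ x₂)
    (φ : Option ↥X → Z) (ψ : Option ↥Y → Z)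
    (hφ : ∀ p q : Option ↥X, dist (φ p) (φ q) = hedgehogDist (fun x : X => (x : ℝ)) p q)
    (hψ : ∀ p q : Option ↥Y, dist (ψ p) (ψ q) = hedgehogDist (fun y : Y => (y : ℝ)) p q)
    (hcover : ∀ p : Option ↥X, ∃ q : Option ↥Y, dist (φ p) (ψ q) < M) :
    dist (φ none) (ψ none) < 4 * M ∧
    ∀ x : X, 5 * M ≤ (x : ℝ) → ∃ y : Y, dist (φ (some x)) (ψ (some y)) < M := by
  have hcenter : dist (φ none) (ψ none) < 4 * M := by
    obtain ⟨x₁, hx₁, x₂, hx₂, hne, h₁, h₂⟩ := htwo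
    obtain ⟨q₀, hq₀⟩ := hcover none
    obtain ⟨q₁, hq₁⟩ := hcover (some ⟨x₁, hx₁⟩)
    obtain ⟨q₂, hq₂⟩ := hcover (some ⟨x₂, hx₂⟩)
    have h₀₁ := abs_lt.1 (abs_dist_sub_dist_lt_two_mul hq₀ hq₁)
    have h₀₂ := abs_lt.1 (abs_dist_sub_dist_lt_two_mul hq₀ hq₂)
    have h₁₂ := abs_lt.1 (abs_dist_sub_dist_lt_two_mul hq₁ hq₂)
    have htri := dist_triangle (φ none) (ψ q₀) (ψ none)
    simp only [hφ, hψ] at h₀₁ h₀₂ h₁₂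
    rw [hψ] at htri
    simp only [hedgehogDist, Subtype.mk.injEq, if_neg hne] at h₀₁ h₀₂ h₁₂
    rcases q₀ with _ | y₀ <;> rcases q₁ with _ | y₁ <;> rcases q₂ with _ | y₂ <;>
      simp only [hedgehogDist] at h₀₁ h₀₂ h₁₂ htri <;>
      (try split_ifs at h₀₁ h₀₂ h₁₂) <;>
      linarith [h₀₁.1, h₀₁.2, h₀₂.1, h₀₂.2, h₁₂.1, h₁₂.2]
  refine ⟨hcenter, fun x hx => ?_⟩
  obtain ⟨_ | y, hq⟩ := hcover (some x)
  · have hlen : dist (φ none) (φ (some x)) = x := hφ none (some x)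
    have htri := dist_triangle_right (φ none) (φ (some x)) (ψ none)
    linarith
  · exact ⟨y, hq⟩
end

section
/- For nonempty subsets X, Y ⊆ (0,∞), if dGH(X̂, Ŷ) = 0 then the closure of X in ℝ equals the closure of Y in ℝ. -/
set_option linter.unusedVariables false
set_option linter.unreachableTactic false
set_option linter.unusedTactic false

open scoped ENNReal

theorem exists_correspondence_of_GHDist_eq_zero {X Y : Type*} [MetricSpace X] [MetricSpace Y]
    (h : GHDist X Y = 0) {ε : ℝ} (hε : 0 < ε) :
    ∃ R : Set (X × Y), IsCorrespondence R ∧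
      ∀ p ∈ R, ∀ q ∈ R, |dist p.1 q.1 - dist p.2 q.2| < ε := by
  rw [GHDist, ENNReal.div_eq_zero_iff] at h
  have hlt : (⨅ R : {R : Set (X × Y) // IsCorrespondence R}, distortion R.1) <
      ENNReal.ofReal ε := by
    rw [h.resolve_right (by simp)]
    exact ENNReal.ofReal_pos.2 hε
  obtain ⟨⟨R, hR⟩, hRε⟩ := iInf_lt_iff.1 hlt
  refine ⟨R, hR, fun p hp q hq => (ENNReal.ofReal_lt_ofReal_iff hε).1 (lt_of_le_of_lt ?_ hRε)⟩
  exact le_trans (le_iSup₂ (f := fun q (_ : q ∈ R) =>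
    ENNReal.ofReal |dist p.1 q.1 - dist p.2 q.2|) q hq)
    (le_iSup₂ (f := fun p (_ : p ∈ R) => ⨆ q ∈ R,
      ENNReal.ofReal |dist p.1 q.1 - dist p.2 q.2|) p hp)

theorem IsCorrespondence.swap {X Y : Type*} {R : Set (X × Y)} (hR : IsCorrespondence R) :
    IsCorrespondence (Prod.swap ⁻¹' R) :=
  ⟨hR.2, hR.1⟩

/-- A correspondence of small distortion between hedgehogs relates every long needle of the
first to a needle of nearly the same length in the second. -/
theorem IsCorrespondence.exists_needle_near {A B : Type*} {f : A → ℝ} {g : B → ℝ}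
    (hf : ∀ a, 0 < f a) (hg : ∀ b, 0 < g b) {R : Set (Option A × Option B)}
    (hR : IsCorrespondence R) {ε : ℝ}
    (hdis : ∀ p ∈ R, ∀ q ∈ R, |hedgehogDist f p.1 q.1 - hedgehogDist g p.2 q.2| < ε)
    {a : A} (ha : 3 * ε < f a) : ∃ b, |f a - g b| < 3 * ε := by
  obtain ⟨u, hu⟩ := hR.1 none
  obtain ⟨v, hv⟩ := hR.1 (some a)
  obtain ⟨w, hw⟩ := hR.2 none
  have huv := abs_lt.1 (hdis _ hu _ hv)
  have huw := abs_lt.1 (hdis _ hu _ hw)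
  have hvw := abs_lt.1 (hdis _ hv _ hw)
  have hfa := hf a
  rcases w with _ | c
  · rcases v with _ | b
    · simp only [hedgehogDist] at hvw
      linarith
    · refine ⟨b, abs_lt.2 ?_⟩
      simp only [hedgehogDist] at hvw
      constructor <;> linarith
  · have hfc := hf c
    by_cases hac : a = c
    · subst hac
      rcases u with _ | b
      · simp only [hedgehogDist] at huw
        linarith
      · refine ⟨b, abs_lt.2 ?_⟩
        simp only [hedgehogDist] at huw
        constructor <;> linarith
    · rcases v with _ | b
      · simp only [hedgehogDist, if_neg hac] at hvw
        linarith
      · refine ⟨b, abs_lt.2 ?_⟩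
        have hgb := hg b
        rcases u with _ | d
        · simp only [hedgehogDist, if_neg hac] at huv huw hvw
          constructor <;> linarith
        · have hgd := hg d
          simp only [hedgehogDist, if_neg hac] at huv huw hvw
          split_ifs at huv <;> constructor <;> linarith

theorem subset_closure_of_hedgehog_correspondences {X Y : Set ℝ}
    (hX : X ⊆ Set.Ioi 0) (hY : Y ⊆ Set.Ioi 0)
    (h : ∀ ε : ℝ, 0 < ε → ∃ R : Set (Option X × Option Y), IsCorrespondence R ∧
      ∀ p ∈ R, ∀ q ∈ R,
        |hedgehogDist (fun x : X => (x : ℝ)) p.1 q.1 -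
          hedgehogDist (fun y : Y => (y : ℝ)) p.2 q.2| < ε) :
    X ⊆ closure Y := by
  intro x hx
  have hx0 : 0 < x := hX hx
  refine Metric.mem_closure_iff.2 fun ε hε => ?_
  have hδ : 0 < min ε x / 4 := by positivity
  have hδε := min_le_left ε x
  have hδx := min_le_right ε x
  obtain ⟨R, hR, hdis⟩ := h _ hδ
  obtain ⟨y, hy⟩ := hR.exists_needle_near (fun x => hX x.2) (fun y => hY y.2) hdis
    (a := ⟨x, hx⟩) (by dsimp only; linarith)
  refine ⟨y, y.2, ?_⟩
  rw [Real.dist_eq]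
  dsimp only at hy
  linarith

/-- If two hedgehogs over nonempty subsets of `(0,∞)` are at zero Gromov–Hausdorff
distance, then the closures of the subsets in `ℝ` coincide. -/
theorem closure_eq_of_hedgehog_GHDist_zero (X Y : Set ℝ)
    (hX : X ⊆ Set.Ioi 0) (hY : Y ⊆ Set.Ioi 0) (hXne : X.Nonempty) (hYne : Y.Nonempty)
    (h : @GHDist (Option ↥X) (Option ↥Y) (hedgehogSet X hX) (hedgehogSet Y hY) = 0) :
    closure X = closure Y := by
  have hcorr := fun (ε : ℝ) (hε : 0 < ε) =>
    @exists_correspondence_of_GHDist_eq_zero _ _ (hedgehogSet X hX) (hedgehogSet Y hY) h ε hε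
  refine Set.Subset.antisymm
    (closure_minimal (subset_closure_of_hedgehog_correspondences hX hY hcorr) isClosed_closure)
    (closure_minimal (subset_closure_of_hedgehog_correspondences hY hX fun ε hε => ?_)
      isClosed_closure)
  obtain ⟨R, hR, hdis⟩ := hcorr ε hε
  refine ⟨_, hR.swap, fun p hp q hq => ?_⟩
  rw [abs_sub_comm]
  exact hdis _ hp _ hq
end

section
/- There exist nonempty countable complete bounded metric spaces X and Y with dGH(X, Y) = 0 such that every point of X is isolated, while Y has exactly one non-isolated point; in particular, X and Y are not homeomorphic, even though they are at zero Gromov–Hausdorff distance. -/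
set_option linter.unusedVariables false
set_option linter.unreachableTactic false
set_option linter.unusedTactic false

open scoped ENNReal

open Filter Topology

/-- The natural numbers, with any two distinct points at distance one. -/
def UnitDiscrete : Type := ℕ

noncomputable instance UnitDiscrete.instMetricSpace : MetricSpace UnitDiscrete where
  dist i j := open Classical in if i = j then 0 else 1
  dist_self i := by simp
  dist_comm i j := by classical exact if_congr eq_comm rfl rfl
  dist_triangle i j k := by
    by_cases hij : i = j <;> by_cases hjk : j = k <;> by_cases hik : i = k <;>
      simp_all
  eq_of_dist_eq_zero {i j} h := by
    by_contra hij
    simp [hij] at h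

namespace UnitDiscrete

instance : Countable UnitDiscrete := inferInstanceAs (Countable ℕ)

theorem dist_eq_one {i j : UnitDiscrete} (h : i ≠ j) : dist i j = 1 := if_neg h

theorem dist_le_one (i j : UnitDiscrete) : dist i j ≤ 1 := by
  by_cases h : i = j
  · simp [h]
  · exact (dist_eq_one h).le

instance : DiscreteUniformity UnitDiscrete where
  eq_bot := Metric.uniformSpace_eq_bot.2 ⟨1, one_pos, fun _ _ h => (dist_eq_one h).ge⟩

theorem dist_map_of_injective {σ : UnitDiscrete → UnitDiscrete} (hσ : σ.Injective)
    (i j : UnitDiscrete) : dist (σ i) (σ j) = dist i j := by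
  by_cases h : i = j
  · simp [h]
  · rw [dist_eq_one h, dist_eq_one (hσ.ne h)]

end UnitDiscrete

/-- A set consisting of `0` and of some reciprocals of positive integers is closed. -/
theorem isClosed_insert_zero_image_one_div (t : Set ℕ) :
    IsClosed (insert (0 : ℝ) ((fun n : ℕ => 1 / ((n : ℝ) + 1)) '' t)) := by
  classical
  have hlim : Tendsto (fun n : ℕ => if n ∈ t then 1 / ((n : ℝ) + 1) else 0) atTop (𝓝 0) := by
    refine squeeze_zero (fun n => ?_) (fun n => ?_) tendsto_one_div_add_atTop_nhds_zero_nat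
    · split_ifs <;> positivity
    · split_ifs
      · exact le_rfl
      · positivity
  convert hlim.isCompact_insert_range.isClosed using 1
  ext x
  simp only [Set.mem_insert_iff, Set.mem_image, Set.mem_range]
  constructor
  · rintro (h | ⟨n, hn, rfl⟩)
    · exact Or.inl h
    · exact Or.inr ⟨n, if_pos hn⟩
  · rintro (h | ⟨n, rfl⟩)
    · exact Or.inl h
    · split_ifs with hn
      · exact Or.inr ⟨n, hn, rfl⟩
      · exact Or.inl rfl

/-- The set `{0, 1, 1/2, …, 1/k}`, where `k` may be infinite. -/
def truncatedHarmonic (k : ℕ∞) : Set ℝ :=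
  insert 0 ((fun n : ℕ => 1 / ((n : ℝ) + 1)) '' {n | (n : ℕ∞) < k})

namespace truncatedHarmonic

theorem zero_mem (k : ℕ∞) : (0 : ℝ) ∈ truncatedHarmonic k := Set.mem_insert _ _

theorem one_div_mem {k : ℕ∞} {n : ℕ} (h : (n : ℕ∞) < k) :
    1 / ((n : ℝ) + 1) ∈ truncatedHarmonic k :=
  Set.mem_insert_of_mem _ ⟨n, h, rfl⟩

theorem isClosed (k : ℕ∞) : IsClosed (truncatedHarmonic k) :=
  isClosed_insert_zero_image_one_div _

theorem countable (k : ℕ∞) : (truncatedHarmonic k).Countable :=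
  ((Set.to_countable _).image _).insert _

theorem mem_Icc {k : ℕ∞} {a : ℝ} (ha : a ∈ truncatedHarmonic k) : a ∈ Set.Icc (0 : ℝ) 1 := by
  rcases ha with rfl | ⟨n, -, rfl⟩
  · simp
  · refine ⟨by positivity, ?_⟩
    rw [div_le_one (by positivity)]
    linarith [(Nat.cast_nonneg n : (0 : ℝ) ≤ n)]

theorem isClosed_diff_singleton {k : ℕ∞} {a : ℝ} (ha : a ∈ truncatedHarmonic k)
    (h : ¬ (a = 0 ∧ k = ⊤)) : IsClosed (truncatedHarmonic k \ {a}) := by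
  rcases eq_or_ne a 0 with rfl | ha0
  · have hk : k ≠ ⊤ := fun hk => h ⟨rfl, hk⟩
    lift k to ℕ using hk
    refine Set.Finite.isClosed (Set.Finite.subset ?_ Set.sdiff_subset)
    refine ((Set.finite_lt_nat k).subset fun n hn => ?_).image _ |>.insert _
    simpa using hn
  · rcases ha with rfl | ⟨n, hn, rfl⟩
    · exact absurd rfl ha0
    · convert isClosed_insert_zero_image_one_div ({m | (m : ℕ∞) < k} \ {n}) using 1
      have hinj : Function.Injective (fun n : ℕ => 1 / ((n : ℝ) + 1)) := fun i j hij => by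
        simpa using hij
      rw [Set.image_sdiff hinj, Set.image_singleton, truncatedHarmonic,
        Set.insert_sdiff_of_notMem _ (by simpa using ha0.symm)]

theorem exists_abs_sub_le {N : ℕ} {k l : ℕ∞} {a : ℝ} (ha : a ∈ truncatedHarmonic k)
    (h : k = l ∨ (N : ℕ∞) ≤ l) :
    ∃ b ∈ truncatedHarmonic l, |a - b| ≤ 1 / ((N : ℝ) + 1) := by
  have hpos : (0 : ℝ) ≤ 1 / ((N : ℝ) + 1) := by positivity
  rcases h with rfl | h
  · exact ⟨a, ha, by simpa using hpos⟩
  rcases ha with rfl | ⟨n, -, rfl⟩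
  · exact ⟨0, zero_mem l, by simpa using hpos⟩
  · rcases lt_or_ge n N with hn | hn
    · exact ⟨_, one_div_mem ((Nat.cast_lt.2 hn).trans_le h), by simpa using hpos⟩
    · refine ⟨0, zero_mem l, ?_⟩
      rw [sub_zero, abs_of_nonneg (by positivity)]
      exact Nat.one_div_le_one_div hn

end truncatedHarmonic

/-- The disjoint union of the sets `truncatedHarmonic (f k)`, `k ∈ ℕ`, distinct pieces being
at distance one from each other. -/
def HarmonicUnion (f : UnitDiscrete → ℕ∞) : Set (ℝ × UnitDiscrete) :=
  {p | p.1 ∈ truncatedHarmonic (f p.2)}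

namespace HarmonicUnion

variable {f g : UnitDiscrete → ℕ∞}

theorem isClosed (f : UnitDiscrete → ℕ∞) : IsClosed (HarmonicUnion f) := by
  rw [← isOpen_compl_iff, isOpen_iff_mem_nhds]
  rintro ⟨a, k⟩ hp
  refine mem_of_superset (((truncatedHarmonic.isClosed (f k)).isOpen_compl.prod
    (isOpen_discrete {k})).mem_nhds ⟨hp, rfl⟩) ?_
  rintro ⟨b, j⟩ ⟨hb, rfl⟩
  exact hb

instance : CompleteSpace (HarmonicUnion f) :=
  (isClosed f).completeSpace_coe

instance : Countable (HarmonicUnion f) := by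
  refine Set.Countable.to_subtype (Set.Countable.mono ?_
    ((truncatedHarmonic.countable ⊤).prod (Set.countable_univ (α := UnitDiscrete))))
  rintro ⟨a, k⟩ (rfl | ⟨n, -, rfl⟩)
  · exact ⟨truncatedHarmonic.zero_mem ⊤, trivial⟩
  · exact ⟨truncatedHarmonic.one_div_mem (ENat.natCast_lt_top n), trivial⟩

/-- The limit point of a piece. -/
def zero (f : UnitDiscrete → ℕ∞) (k : UnitDiscrete) : HarmonicUnion f :=
  ⟨(0, k), truncatedHarmonic.zero_mem _⟩

theorem dist_le_one (p q : HarmonicUnion f) : dist p q ≤ 1 :=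
  max_le (Real.dist_le_of_mem_Icc_01 (truncatedHarmonic.mem_Icc p.2)
    (truncatedHarmonic.mem_Icc q.2)) (UnitDiscrete.dist_le_one _ _)

theorem isOpen_singleton_iff (p : HarmonicUnion f) :
    IsOpen {p} ↔ ¬ (p.1.1 = 0 ∧ f p.1.2 = ⊤) := by
  obtain ⟨⟨a, k⟩, hp⟩ := p
  constructor
  · rintro ho ⟨rfl : a = 0, hk : f k = ⊤⟩
    have hlim : Tendsto (fun n : ℕ => (⟨(1 / ((n : ℝ) + 1), k),
        truncatedHarmonic.one_div_mem (hk ▸ ENat.natCast_lt_top n)⟩ : HarmonicUnion f))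
        atTop (𝓝 ⟨(0, k), hp⟩) :=
      tendsto_subtype_rng.2
        (tendsto_one_div_add_atTop_nhds_zero_nat.prodMk_nhds tendsto_const_nhds)
    obtain ⟨n, hn⟩ := (hlim.eventually (ho.mem_nhds rfl)).exists
    have h0 : 1 / ((n : ℝ) + 1) = 0 := congrArg (fun p => p.1.1) hn
    have : 0 < 1 / ((n : ℝ) + 1) := by positivity
    exact this.ne' h0
  · intro h
    have ho := ((truncatedHarmonic.isClosed_diff_singleton hp h).isOpen_compl.prod
      (isOpen_discrete {k})).preimage (continuous_subtype_val (p := (· ∈ HarmonicUnion f)))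
    convert ho using 1
    ext ⟨⟨b, j⟩, hq⟩
    simp only [Set.mem_singleton_iff, Subtype.mk.injEq, Prod.mk.injEq, Set.mem_preimage,
      Set.mem_prod, Set.mem_compl_iff, Set.mem_sdiff, not_and, not_not]
    constructor
    · rintro ⟨rfl, rfl⟩
      exact ⟨fun _ => rfl, rfl⟩
    · rintro ⟨hb, rfl⟩
      exact ⟨hb hq, rfl⟩

/-- If a permutation of the pieces matches equal pieces or pieces with at least `N` reciprocals,
then the unions are at Gromov–Hausdorff distance at most `1 / (N + 1)`. -/
theorem GHDist_le {σ : UnitDiscrete → UnitDiscrete} (hσ : σ.Bijective) (N : ℕ)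
    (h : ∀ k, f k = g (σ k) ∨ (N : ℕ∞) ≤ f k ∧ (N : ℕ∞) ≤ g (σ k)) :
    GHDist (HarmonicUnion f) (HarmonicUnion g) ≤ ENNReal.ofReal (1 / ((N : ℝ) + 1)) := by
  set ε : ℝ := 1 / ((N : ℝ) + 1)
  let R : Set (HarmonicUnion f × HarmonicUnion g) :=
    {p | |p.1.1.1 - p.2.1.1| ≤ ε ∧ σ p.1.1.2 = p.2.1.2}
  have hR : IsCorrespondence R := by
    constructor
    · rintro ⟨⟨a, k⟩, ha⟩
      obtain ⟨b, hb, hab⟩ := truncatedHarmonic.exists_abs_sub_le ha ((h k).imp_right And.right)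
      exact ⟨⟨(b, σ k), hb⟩, hab, rfl⟩
    · rintro ⟨⟨b, j⟩, hb⟩
      obtain ⟨k, rfl⟩ := hσ.2 j
      obtain ⟨a, ha, hab⟩ := truncatedHarmonic.exists_abs_sub_le hb
        ((h k).imp Eq.symm And.left)
      exact ⟨⟨(a, k), ha⟩, by rwa [abs_sub_comm], rfl⟩
  have hdis : distortion R ≤ ENNReal.ofReal (2 * ε) := by
    refine iSup₂_le fun p hp => iSup₂_le fun q hq => ENNReal.ofReal_le_ofReal ?_
    obtain ⟨⟨⟨a, k⟩, _⟩, ⟨⟨b, j⟩, _⟩⟩ := p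
    obtain ⟨⟨⟨a', k'⟩, _⟩, ⟨⟨b', j'⟩, _⟩⟩ := q
    obtain ⟨hab : |a - b| ≤ ε, hj : σ k = j⟩ := hp
    subst hj
    obtain ⟨hab' : |a' - b'| ≤ ε, hj' : σ k' = j'⟩ := hq
    subst hj'
    change |max (dist a a') (dist k k') - max (dist b b') (dist (σ k) (σ k'))| ≤ 2 * ε
    rw [UnitDiscrete.dist_map_of_injective hσ.1]
    refine (abs_max_sub_max_le_abs _ _ _).trans ?_
    have := dist_dist_dist_le a a' b b'
    simp only [Real.dist_eq] at this ⊢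
    linarith
  calc GHDist (HarmonicUnion f) (HarmonicUnion g)
      ≤ ENNReal.ofReal (2 * ε) / 2 :=
        ENNReal.div_le_div_right ((iInf_le _ ⟨R, hR⟩).trans hdis) 2
    _ = ENNReal.ofReal ε := by
        rw [ENNReal.ofReal_mul zero_le_two, ENNReal.ofReal_ofNat, mul_comm,
          ENNReal.mul_div_cancel_right two_ne_zero ENNReal.ofNat_ne_top]

/-- Prepending an infinite piece to the union of all the finite pieces does not change the
Gromov–Hausdorff class. -/
theorem GHDist_prepend_top :
    GHDist (HarmonicUnion fun k : ℕ => (k : ℕ∞))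
      (HarmonicUnion fun k : ℕ => if k = 0 then ⊤ else ((k - 1 : ℕ) : ℕ∞)) = 0 := by
  have hlim : Tendsto (fun N : ℕ => ENNReal.ofReal (1 / ((N : ℝ) + 1))) atTop (𝓝 0) := by
    simpa using ENNReal.tendsto_ofReal (tendsto_one_div_add_atTop_nhds_zero_nat (𝕜 := ℝ))
  refine le_antisymm (ge_of_tendsto' hlim fun N => ?_) zero_le
  let σ : ℕ → ℕ := fun k => if k < N then k + 1 else if k = N then 0 else k
  have hσ : σ.Bijective := by
    constructor
    · intro i j hij
      simp only [σ] at hij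
      split_ifs at hij <;> omega
    · intro j
      rcases Nat.eq_zero_or_pos j with rfl | hj
      · exact ⟨N, by simp [σ]⟩
      · by_cases hjN : j ≤ N
        · exact ⟨j - 1, by simp only [σ]; split_ifs <;> omega⟩
        · exact ⟨j, by simp only [σ]; split_ifs <;> omega⟩
  refine GHDist_le (σ := σ) hσ N fun (k : ℕ) => ?_
  rcases lt_trichotomy k N with hk | rfl | hk
  · left
    simp [σ, hk]
  · right
    simp [σ]
  · right
    have h0 : k ≠ 0 := by omega
    simp only [σ, hk.not_gt, hk.ne', h0, if_false, Nat.cast_le]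
    omega

end HarmonicUnion

/-- There are countable complete bounded metric spaces `X` and `Y` at zero
Gromov–Hausdorff distance such that every point of `X` is isolated while `Y` has
exactly one non-isolated point; in particular `X` and `Y` are not homeomorphic. -/
theorem exists_nonhomeomorphic_zero_GHDist :
    ∃ (X Y : Type) (mX : MetricSpace X) (mY : MetricSpace Y),
      Nonempty X ∧ Nonempty Y ∧ Countable X ∧ Countable Y ∧
      @CompleteSpace X mX.toPseudoMetricSpace.toUniformSpace ∧
      @CompleteSpace Y mY.toPseudoMetricSpace.toUniformSpace ∧
      (∃ C : ℝ, ∀ a b : X, @dist X mX.toPseudoMetricSpace.toDist a b ≤ C) ∧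
      (∃ C : ℝ, ∀ a b : Y, @dist Y mY.toPseudoMetricSpace.toDist a b ≤ C) ∧
      @GHDist X Y mX mY = 0 ∧
      (∀ x : X,
        @IsOpen X mX.toPseudoMetricSpace.toUniformSpace.toTopologicalSpace {x}) ∧
      (∃! y : Y,
        ¬ @IsOpen Y mY.toPseudoMetricSpace.toUniformSpace.toTopologicalSpace {y}) ∧
      ¬ Nonempty (@Homeomorph X Y
        mX.toPseudoMetricSpace.toUniformSpace.toTopologicalSpace
        mY.toPseudoMetricSpace.toUniformSpace.toTopologicalSpace) := by
  let f : UnitDiscrete → ℕ∞ := fun k : ℕ => k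
  let g : UnitDiscrete → ℕ∞ := fun k : ℕ => if k = 0 then ⊤ else ((k - 1 : ℕ) : ℕ∞)
  have hX : ∀ x : HarmonicUnion f, IsOpen {x} := fun x =>
    (HarmonicUnion.isOpen_singleton_iff x).2 fun h => ENat.natCast_ne_top _ h.2
  have hg : ∀ k : ℕ, g k = ⊤ → k = 0 := fun k hk => by
    by_contra h
    simp only [g, h, if_false] at hk
    exact ENat.natCast_ne_top _ hk
  have hzero : ¬ IsOpen {HarmonicUnion.zero g (0 : ℕ)} := fun h =>
    (HarmonicUnion.isOpen_singleton_iff _).1 h ⟨rfl, if_pos rfl⟩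
  refine ⟨HarmonicUnion f, HarmonicUnion g, inferInstance, inferInstance,
    ⟨HarmonicUnion.zero f (0 : ℕ)⟩, ⟨HarmonicUnion.zero g (0 : ℕ)⟩, inferInstance, inferInstance,
    inferInstance, inferInstance, ⟨1, HarmonicUnion.dist_le_one⟩,
    ⟨1, HarmonicUnion.dist_le_one⟩, HarmonicUnion.GHDist_prepend_top, hX,
    ⟨HarmonicUnion.zero g (0 : ℕ), hzero, fun y hy => ?_⟩, ?_⟩
  · replace hy := not_not.1 (mt (HarmonicUnion.isOpen_singleton_iff y).2 hy)
    exact Subtype.ext (Prod.ext hy.1 (hg _ hy.2))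
  · rintro ⟨e⟩
    refine hzero ?_
    have h := e.isOpenMap _ (hX (e.symm (HarmonicUnion.zero g (0 : ℕ))))
    rwa [Set.image_singleton, e.apply_symm_apply] at h
end

section
/- For a nonempty subset X ⊆ (0,∞), the following are equivalent: (1) dGH(X̂, Q̂₊) = 0, where Q̂₊ is the hedgehog over ℚ ∩ (0,∞); (2) X is countable and dense in (0,∞). -/
set_option linter.unusedVariables false
set_option linter.unreachableTactic false
set_option linter.unusedTactic false

open scoped ENNReal

/-- The set of positive rational numbers, as a subset of `ℝ`. -/
def Qpos : Set ℝ := {x : ℝ | 0 < x ∧ ∃ q : ℚ, (q : ℝ) = x}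

lemma Qpos_subset : Qpos ⊆ Set.Ioi 0 := fun _ h => h.1

/-- The Gromov–Hausdorff distance vanishes iff there are correspondences of arbitrarily small
distortion. -/
lemma GHDist_eq_zero_iff {X Y : Type*} [MetricSpace X] [MetricSpace Y] :
    GHDist X Y = 0 ↔ ∀ ε : ℝ, 0 < ε → ∃ R : Set (X × Y), IsCorrespondence R ∧
      ∀ p ∈ R, ∀ q ∈ R, |dist p.1 q.1 - dist p.2 q.2| ≤ ε := by
  have hdist : ∀ (R : Set (X × Y)) (ε : ℝ), 0 < ε → (distortion R ≤ ENNReal.ofReal ε ↔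
      ∀ p ∈ R, ∀ q ∈ R, |dist p.1 q.1 - dist p.2 q.2| ≤ ε) := fun R ε hε => by
    simp only [distortion, iSup_le_iff, ENNReal.ofReal_le_ofReal_iff hε.le]
  have hzero : GHDist X Y = 0 ↔
      ⨅ R : {R : Set (X × Y) // IsCorrespondence R}, distortion R.1 = 0 := by
    simp [GHDist, ENNReal.div_eq_zero_iff]
  rw [hzero]
  constructor
  · intro h ε hε
    have hlt : ⨅ R : {R : Set (X × Y) // IsCorrespondence R}, distortion R.1
        < ENNReal.ofReal ε := by
      rw [h]; exact ENNReal.ofReal_pos.2 hε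
    obtain ⟨R, hR⟩ := iInf_lt_iff.1 hlt
    exact ⟨R.1, R.2, (hdist _ ε hε).1 hR.le⟩
  · intro h
    refine le_antisymm (ENNReal.le_of_forall_pos_le_add fun ε hε _ => ?_) zero_le
    obtain ⟨R, hR, hRε⟩ := h ε hε
    rw [zero_add]
    refine (iInf_le _ ⟨R, hR⟩).trans ?_
    simpa using (hdist R ε hε).2 hRε

/-- The distance of a point of a hedgehog from the center. -/
def needleLength {A : Type*} (f : A → ℝ) : Option A → ℝ
  | none => 0
  | some a => f a

@[simp] lemma needleLength_none {A : Type*} (f : A → ℝ) : needleLength f none = 0 := rfl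

@[simp] lemma needleLength_some {A : Type*} (f : A → ℝ) (a : A) :
    needleLength f (some a) = f a := rfl

lemma hedgehogDist_self {A : Type*} (f : A → ℝ) (a : Option A) : hedgehogDist f a a = 0 := by
  cases a <;> simp [hedgehogDist]

lemma hedgehogDist_of_ne {A : Type*} (f : A → ℝ) {a b : Option A} (h : a ≠ b) :
    hedgehogDist f a b = needleLength f a + needleLength f b := by
  cases a <;> cases b <;> simp_all [hedgehogDist, needleLength]

lemma hedgehogDist_none_left {A : Type*} (f : A → ℝ) (a : Option A) :
    hedgehogDist f none a = needleLength f a := by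
  cases a <;> simp [hedgehogDist, needleLength]

lemma hedgehogDist_none_right {A : Type*} (f : A → ℝ) (a : Option A) :
    hedgehogDist f a none = needleLength f a := by
  cases a <;> simp [hedgehogDist, needleLength]

lemma needleLength_nonneg {A : Type*} {f : A → ℝ} (hf : ∀ a, 0 < f a) (a : Option A) :
    0 ≤ needleLength f a := by
  cases a with
  | none => exact le_rfl
  | some a => exact (hf a).le

/-- A correspondence of distortion at most `ε` with a hedgehog having arbitrarily long needles
relates the center to points close to the center. -/
lemma needleLength_le_of_none_related {A B : Type*} {f : A → ℝ} {g : B → ℝ}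
    (hg : ∀ b, 0 < g b) (hunb : ∀ M : ℝ, ∃ b, M < g b)
    {R : Set (Option A × Option B)} (hR : IsCorrespondence R) {ε : ℝ} (hε : 0 < ε)
    (hRε : ∀ p ∈ R, ∀ q ∈ R, |hedgehogDist f p.1 q.1 - hedgehogDist g p.2 q.2| ≤ ε)
    {y : Option B} (hy : (none, y) ∈ R) : needleLength g y ≤ 2 * ε := by
  obtain ⟨z, hz⟩ := hR.2 none
  obtain ⟨b, hb⟩ := hunb (2 * ε + needleLength g y)
  obtain ⟨x, hx⟩ := hR.2 (some b)
  have hy0 := needleLength_nonneg hg y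
  have hyb : y ≠ some b := by
    rintro rfl
    simp only [needleLength_some] at hb
    linarith
  have h₁ := abs_le.1 (hRε _ hy _ hz)
  have h₂ := abs_le.1 (hRε _ hy _ hx)
  have h₃ := abs_le.1 (hRε _ hz _ hx)
  simp only [hedgehogDist_none_left, hedgehogDist_none_right, hedgehogDist_of_ne g hyb]
    at h₁ h₂ h₃
  simp only [needleLength_some] at h₂ h₃ hb
  have hzx : z ≠ x := by
    rintro rfl
    rw [hedgehogDist_self] at h₃
    linarith
  rw [hedgehogDist_of_ne f hzx] at h₃
  linarith

/-- A set of needle lengths is countable if its hedgehog is at Gromov–Hausdorff distance zero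
from a countable hedgehog. -/
lemma countable_of_GHDist_eq_zero {A B : Type*} [Countable B] {f : A → ℝ} {g : B → ℝ}
    (hf : ∀ a, 0 < f a) (hg : ∀ b, 0 < g b)
    (h : @GHDist (Option A) (Option B) (hedgehog f hf) (hedgehog g hg) = 0) :
    Countable A := by
  rw [@GHDist_eq_zero_iff _ _ (hedgehog f hf) (hedgehog g hg)] at h
  have hlarge : ∀ n : ℕ, {a : A | 1 / ((n : ℝ) + 1) < f a}.Countable := fun n => by
    obtain ⟨R, hR, hRε⟩ := h (1 / ((n : ℝ) + 1)) Nat.one_div_pos_of_nat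
    choose φ hφ using fun a : A => hR.1 (some a)
    refine Set.MapsTo.countable_of_injOn (Set.mapsTo_univ φ _) ?_ Set.countable_univ
    intro a ha b hb hab
    by_contra hne
    have hd : |hedgehogDist f (some a) (some b) - hedgehogDist g (φ a) (φ b)|
        ≤ 1 / ((n : ℝ) + 1) := hRε _ (hφ a) _ (hφ b)
    rw [hab, hedgehogDist_self, hedgehogDist_of_ne f (by simpa using hne)] at hd
    have := (abs_le.1 hd).2
    simp only [needleLength_some, Set.mem_ofPred_eq] at this ha hb
    linarith [hf b]
  rw [← Set.countable_univ_iff]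
  refine (Set.countable_iUnion hlarge).mono fun a _ => ?_
  obtain ⟨n, hn⟩ := exists_nat_one_div_lt (hf a)
  exact Set.mem_iUnion.2 ⟨n, hn⟩

/-- Density of needle lengths in `(0,∞)` passes between hedgehogs at Gromov–Hausdorff distance
zero. -/
lemma Ioi_subset_closure_range_of_GHDist_eq_zero {A B : Type*} {f : A → ℝ} {g : B → ℝ}
    (hf : ∀ a, 0 < f a) (hg : ∀ b, 0 < g b)
    (hdense : Set.Ioi (0 : ℝ) ⊆ closure (Set.range g))
    (h : @GHDist (Option A) (Option B) (hedgehog f hf) (hedgehog g hg) = 0) :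
    Set.Ioi (0 : ℝ) ⊆ closure (Set.range f) := by
  rw [@GHDist_eq_zero_iff _ _ (hedgehog f hf) (hedgehog g hg)] at h
  have hnear : ∀ t : ℝ, 0 < t → ∀ δ : ℝ, 0 < δ → ∃ b, |t - g b| < δ := fun t ht δ hδ => by
    obtain ⟨_, ⟨b, rfl⟩, hb⟩ := Metric.mem_closure_iff.1 (hdense ht) δ hδ
    exact ⟨b, hb⟩
  have hunb : ∀ M : ℝ, ∃ b, M < g b := fun M => by
    obtain ⟨b, hb⟩ := hnear (|M| + 1) (by positivity) 1 one_pos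
    exact ⟨b, by linarith [(abs_lt.1 hb).2, le_abs_self M]⟩
  intro t ht
  have ht : 0 < t := ht
  refine Metric.mem_closure_iff.2 fun δ hδ => ?_
  obtain ⟨ε, hε, hεt, hεδ⟩ : ∃ ε : ℝ, 0 < ε ∧ 4 * ε < t ∧ 4 * ε < δ := by
    refine ⟨min t δ / 5, by positivity, ?_, ?_⟩
    · linarith [min_le_left t δ]
    · linarith [min_le_right t δ, lt_min ht hδ]
  obtain ⟨R, hR, hRε⟩ := h ε hε
  obtain ⟨b, hb⟩ := hnear t ht ε hε
  obtain ⟨y, hy⟩ := hR.1 none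
  obtain ⟨x, hx⟩ := hR.2 (some b)
  have hy2 := needleLength_le_of_none_related hg hunb hR hε hRε hy
  have hy0 := needleLength_nonneg hg y
  have hxy : |hedgehogDist f none x - hedgehogDist g y (some b)| ≤ ε := hRε _ hy _ hx
  rw [hedgehogDist_none_left] at hxy
  have hyb : |hedgehogDist g y (some b) - g b| ≤ 2 * ε := by
    by_cases hne : y = some b
    · subst hne
      simp only [needleLength_some] at hy2 hy0
      rw [hedgehogDist_self, abs_le]
      constructor <;> linarith
    · rw [hedgehogDist_of_ne g hne]
      simp only [needleLength_some]
      rw [abs_le]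
      constructor <;> linarith
  rw [abs_le] at hxy hyb
  rw [abs_lt] at hb
  cases x with
  | none =>
    simp only [needleLength_none] at hxy
    linarith
  | some a =>
    simp only [needleLength_some] at hxy
    refine ⟨f a, ⟨a, rfl⟩, ?_⟩
    rw [Real.dist_eq, abs_lt]
    constructor <;> linarith

/-- Hedgehogs whose needles correspond bijectively with arbitrarily small changes of length are
at Gromov–Hausdorff distance zero. -/
lemma GHDist_hedgehog_eq_zero_of_equiv {A B : Type*} {f : A → ℝ} {g : B → ℝ}
    (hf : ∀ a, 0 < f a) (hg : ∀ b, 0 < g b)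
    (h : ∀ ε : ℝ, 0 < ε → ∃ e : A ≃ B, ∀ a, |f a - g (e a)| ≤ ε) :
    @GHDist (Option A) (Option B) (hedgehog f hf) (hedgehog g hg) = 0 := by
  rw [@GHDist_eq_zero_iff _ _ (hedgehog f hf) (hedgehog g hg)]
  intro ε hε
  obtain ⟨e, he⟩ := h (ε / 2) (half_pos hε)
  have hlen : ∀ a : Option A,
      |needleLength f a - needleLength g (e.optionCongr a)| ≤ ε / 2 := fun a => by
    cases a with
    | none => simpa [needleLength] using (half_pos hε).le
    | some a => simpa [needleLength] using he a
  refine ⟨Set.range fun a => (a, e.optionCongr a),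
    ⟨fun a => ⟨_, a, rfl⟩, fun b => ⟨e.optionCongr.symm b, e.optionCongr.symm b,
      Prod.ext rfl (e.optionCongr.apply_symm_apply b)⟩⟩, ?_⟩
  rintro _ ⟨a, rfl⟩ _ ⟨b, rfl⟩
  change |hedgehogDist f a b - hedgehogDist g (e.optionCongr a) (e.optionCongr b)| ≤ ε
  by_cases hab : a = b
  · subst hab
    simpa [hedgehogDist_self] using hε.le
  · rw [hedgehogDist_of_ne f hab, hedgehogDist_of_ne g (e.optionCongr.injective.ne hab)]
    have ha := abs_le.1 (hlen a)
    have hb := abs_le.1 (hlen b)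
    rw [abs_le]
    constructor <;> linarith

/-- A dense subset of `(0,∞)` meets each interval `[k ε, (k + 1) ε)` in an infinite set. -/
lemma infinite_floor_fiber {S : Set ℝ} (hdense : Set.Ioi (0 : ℝ) ⊆ closure S)
    {ε : ℝ} (hε : 0 < ε) (k : ℕ) : Infinite {x : S // ⌊(x : ℝ) / ε⌋₊ = k} := by
  have hk : (0 : ℝ) ≤ k * ε := by positivity
  have hinf : (Set.Ioo (k * ε) ((k + 1) * ε) ∩ S).Infinite := fun hfin => by
    have hsub : Set.Ioo (k * ε) ((k + 1) * ε) ⊆ Set.Ioo (k * ε) ((k + 1) * ε) ∩ S := by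
      intro x hx
      rw [← hfin.isClosed.closure_eq]
      exact isOpen_Ioo.inter_closure ⟨hx, hdense (hk.trans_lt hx.1)⟩
    exact Set.Ioo_infinite (by nlinarith) (hfin.subset hsub)
  have := hinf.to_subtype
  refine Infinite.of_injective
    (fun x : ↥(Set.Ioo (k * ε) ((k + 1) * ε) ∩ S) =>
      (⟨⟨x.1, x.2.2⟩, ?_⟩ : {x : S // ⌊(x : ℝ) / ε⌋₊ = k})) fun x y hxy => ?_
  · have hx := x.2.1
    rw [Nat.floor_eq_iff (div_nonneg (hk.trans hx.1.le) hε.le), le_div_iff₀ hε, div_lt_iff₀ hε]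
    exact ⟨hx.1.le, hx.2⟩
  · simpa [Subtype.ext_iff] using hxy

/-- Two countable dense subsets of `(0,∞)` admit bijections moving points arbitrarily little. -/
lemma exists_equiv_abs_sub_le {S T : Set ℝ} (hS : S ⊆ Set.Ioi 0) (hT : T ⊆ Set.Ioi 0)
    (hSc : S.Countable) (hTc : T.Countable) (hSd : Set.Ioi (0 : ℝ) ⊆ closure S)
    (hTd : Set.Ioi (0 : ℝ) ⊆ closure T) {ε : ℝ} (hε : 0 < ε) :
    ∃ e : S ≃ T, ∀ x : S, |(x : ℝ) - e x| ≤ ε := by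
  have := hSc.to_subtype
  have := hTc.to_subtype
  have hfib : ∀ k : ℕ, Nonempty
      ({x : S // ⌊(x : ℝ) / ε⌋₊ = k} ≃ {y : T // ⌊(y : ℝ) / ε⌋₊ = k}) := fun k => by
    have := infinite_floor_fiber hSd hε k
    have := infinite_floor_fiber hTd hε k
    exact nonempty_equiv_of_countable
  refine ⟨Equiv.ofFiberEquiv fun k => (hfib k).some, fun x => ?_⟩
  set y := Equiv.ofFiberEquiv (fun k => (hfib k).some) x with hy
  have hfloor : ⌊(y : ℝ) / ε⌋₊ = ⌊(x : ℝ) / ε⌋₊ :=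
    Equiv.ofFiberEquiv_map (fun k => (hfib k).some) x
  have hx0 : 0 < (x : ℝ) := hS x.2
  have hy0 : 0 < (y : ℝ) := hT y.2
  have hx₁ := (Nat.floor_eq_iff (div_nonneg hx0.le hε.le)).1 rfl
  have hy₁ := (Nat.floor_eq_iff (div_nonneg hy0.le hε.le)).1 hfloor
  rw [le_div_iff₀ hε, div_lt_iff₀ hε] at hx₁ hy₁
  rw [abs_le]
  constructor <;> linarith

lemma Qpos_countable : Qpos.Countable :=
  (Set.countable_range ((↑) : ℚ → ℝ)).mono fun _ h => h.2

lemma Ioi_subset_closure_Qpos : Set.Ioi (0 : ℝ) ⊆ closure Qpos := by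
  intro t ht
  refine Metric.mem_closure_iff.2 fun δ hδ => ?_
  obtain ⟨q, hq₁, hq₂⟩ := exists_rat_btwn (lt_add_of_pos_right t hδ)
  refine ⟨q, ⟨lt_trans ht hq₁, q, rfl⟩, ?_⟩
  rw [Real.dist_eq, abs_lt]
  constructor <;> linarith

/-- A hedgehog over `X ⊆ (0,∞)` is at zero Gromov–Hausdorff distance from the
hedgehog over the positive rationals iff `X` is countable and dense in `(0,∞)`. -/
theorem hedgehog_zero_dist_from_Qpos_iff (X : Set ℝ) (hX : X ⊆ Set.Ioi 0)
    (hXne : X.Nonempty) :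
    @GHDist (Option ↥X) (Option ↥Qpos) (hedgehogSet X hX) (hedgehogSet Qpos Qpos_subset)
        = 0 ↔
      X.Countable ∧ Set.Ioi (0 : ℝ) ⊆ closure X := by
  constructor
  · intro h
    have := Qpos_countable.to_subtype
    refine ⟨Set.countable_coe_iff.1 (countable_of_GHDist_eq_zero _ _ h), ?_⟩
    simpa using Ioi_subset_closure_range_of_GHDist_eq_zero _ _
      (by simpa using Ioi_subset_closure_Qpos) h
  · rintro ⟨hc, hd⟩
    exact GHDist_hedgehog_eq_zero_of_equiv _ _ fun ε hε =>
      exists_equiv_abs_sub_le hX Qpos_subset hc Qpos_countable hd Ioi_subset_closure_Qpos hε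
end

section
/- There exists a family (Y_t) of nonempty complete metric spaces indexed by the real numbers t ∈ ℝ, pairwise non-isometric (Y_s is not isometric to Y_t for s ≠ t), such that dGH(Y_t, Q̂₊) = 0 for every t, where Q̂₊ is the hedgehog over ℚ ∩ (0,∞). (Hence there exist continuum many pairwise non-isometric complete metric spaces at zero Gromov–Hausdorff distance from Q̂₊.) -/
set_option linter.unusedVariables false
set_option linter.unreachableTactic false
set_option linter.unusedTactic false

open scoped ENNReal

lemma le_hedgehogDist_some {A : Type*} {f : A → ℝ} (hf : ∀ a, 0 < f a) (a : A) {y : Option A}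
    (hy : y ≠ some a) : f a ≤ hedgehogDist f (some a) y := by
  rcases y with _ | b
  · exact le_rfl
  · have hab : a ≠ b := fun h => hy (by rw [h])
    simp only [hedgehogDist, if_neg hab]
    linarith [hf b]

lemma completeSpace_hedgehog {A : Type*} (f : A → ℝ) (hf : ∀ a, 0 < f a) :
    @CompleteSpace (Option A) (hedgehog f hf).toPseudoMetricSpace.toUniformSpace := by
  let _ := hedgehog f hf
  refine Metric.complete_of_cauchySeq_tendsto fun u hu => ?_
  by_cases h : Filter.Tendsto u Filter.atTop (nhds none)
  · exact ⟨none, h⟩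
  rw [Metric.tendsto_atTop] at h
  push Not at h
  obtain ⟨ε, hε, h⟩ := h
  obtain ⟨N, hN⟩ := Metric.cauchySeq_iff.1 hu ε hε
  obtain ⟨n, hn, hfar⟩ := h N
  refine ⟨u n, tendsto_const_nhds.congr' ?_⟩
  filter_upwards [Filter.eventually_ge_atTop N] with m hm
  by_contra hne
  rcases hun : u n with _ | a
  · rw [hun, dist_self] at hfar
    linarith
  · have h1 : ε ≤ f a := by rw [hun] at hfar; exact hfar
    have h2 : f a ≤ dist (u n) (u m) := by
      rw [hun]
      exact le_hedgehogDist_some hf a fun h => hne (hun.trans h.symm)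
    linarith [hN n hn m hm]

/-- A distance-preserving bijection of hedgehogs fixes the center as soon as the source has
arbitrarily short needles. -/
lemma hedgehog_isometry_center {A B : Type*} {f : A → ℝ} {g : B → ℝ} (hg : ∀ b, 0 < g b)
    (hshort : ∀ ε > 0, ∃ a, f a < ε) (F : Option A ≃ Option B)
    (hF : ∀ x y, hedgehogDist g (F x) (F y) = hedgehogDist f x y) : F none = none := by
  rcases h : F none with _ | b
  · rfl
  · obtain ⟨a, ha⟩ := hshort (g b) (hg b)
    have hne : F (some a) ≠ some b := fun h' => by
      simpa using F.injective (h'.trans h.symm)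
    have h1 := le_hedgehogDist_some hg b hne
    rw [← h, hF] at h1
    exact absurd h1 (not_le.2 ha)

/-- Hedgehogs whose needles can be matched bijectively with arbitrarily small changes of length
are at zero Gromov–Hausdorff distance. -/
lemma GHDist_hedgehog_eq_zero {A B : Type*} (f : A → ℝ) (g : B → ℝ) (hf : ∀ a, 0 < f a)
    (hg : ∀ b, 0 < g b) (h : ∀ ε > 0, ∃ e : A ≃ B, ∀ a, |f a - g (e a)| ≤ ε) :
    @GHDist (Option A) (Option B) (hedgehog f hf) (hedgehog g hg) = 0 := by
  let _ := hedgehog f hf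
  let _ := hedgehog g hg
  have key : (⨅ R : {R : Set (Option A × Option B) // IsCorrespondence R}, distortion R.1) = 0 := by
    refine le_antisymm (ENNReal.le_of_forall_pos_le_add fun δ hδ _ => ?_) bot_le
    obtain ⟨e, he⟩ := h (δ / 2) (by positivity)
    refine (iInf_le _ ⟨{p | p.2 = p.1.map e}, fun x => ⟨x.map e, by simp⟩,
      fun y => ⟨y.map e.symm, by simp⟩⟩).trans ?_
    rw [zero_add]
    refine iSup₂_le fun p hp => iSup₂_le fun q hq => ENNReal.ofReal_le_of_le_toReal ?_
    obtain ⟨x, x'⟩ := p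
    obtain ⟨y, y'⟩ := q
    obtain rfl : x' = x.map e := hp
    obtain rfl : y' = y.map e := hq
    have hδ' : (0 : ℝ) < δ := hδ
    change |hedgehogDist f x y - hedgehogDist g (x.map e) (y.map e)| ≤ δ
    rcases x with _ | a <;> rcases y with _ | b <;>
      simp only [hedgehogDist, Option.map_none, Option.map_some]
    · simp
    · linarith [he b]
    · linarith [he a]
    · by_cases hab : a = b
      · simp [hab]
      · rw [if_neg hab, if_neg (e.injective.ne hab)]
        have h1 := abs_le.1 (he a)
        have h2 := abs_le.1 (he b)
        exact abs_le.2 ⟨by linarith, by linarith⟩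
  simp [GHDist, key]

/-- Countably many points can be absorbed into an infinite subset `S` of a countable type,
moving only points of `S`. -/
lemma exists_sum_equiv_of_infinite {α β : Type*} [Countable α] [Countable β] (S : Set α)
    [Infinite S] : ∃ e : α ⊕ β ≃ α,
      (∀ a, e (Sum.inl a) = a ∨ a ∈ S ∧ e (Sum.inl a) ∈ S) ∧ ∀ b, e (Sum.inr b) ∈ S := by
  classical
  obtain ⟨e₀⟩ : Nonempty (S ⊕ β ≃ S) := nonempty_equiv_of_countable
  let e : α ⊕ β ≃ α :=
    (((Equiv.sumCongr (Equiv.Set.sumCompl S).symm (Equiv.refl β)).trans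
      ((Equiv.sumAssoc _ _ _).trans (((Equiv.refl _).sumCongr (Equiv.sumComm _ _)).trans
        (Equiv.sumAssoc _ _ _).symm))).trans
      (Equiv.sumCongr e₀ (Equiv.refl _))).trans (Equiv.Set.sumCompl S)
  refine ⟨e, fun a => ?_, fun b => ?_⟩
  · by_cases ha : a ∈ S
    · exact Or.inr ⟨ha, by simp [e, Equiv.Set.sumCompl_symm_apply_of_mem ha]⟩
    · exact Or.inl (by simp [e, Equiv.Set.sumCompl_symm_apply_of_notMem ha])
  · simp [e]

instance : Countable Qpos :=
  ((Set.countable_range ((↑) : ℚ → ℝ)).mono fun _ h => h.2).to_subtype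

lemma exists_Qpos_between {a b : ℝ} (ha : 0 ≤ a) (hab : a < b) :
    ∃ q : Qpos, a < (q : ℝ) ∧ (q : ℝ) < b := by
  obtain ⟨q, h1, h2⟩ := exists_rat_btwn hab
  exact ⟨⟨q, ha.trans_lt h1, q, rfl⟩, h1, h2⟩

lemma infinite_Qpos_near {x ε : ℝ} (hx : 0 ≤ x) (hε : 0 < ε) :
    Infinite {q : Qpos | |(q : ℝ) - x| ≤ ε} := by
  rw [Set.infinite_coe_iff]
  intro hfin
  have hclose (q : Qpos) (h1 : x < q) (h2 : q ≤ x + ε) : |(q : ℝ) - x| ≤ ε :=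
    abs_le.2 ⟨by linarith, by linarith⟩
  obtain ⟨q₀, h1, h2⟩ := exists_Qpos_between hx (lt_add_of_pos_right x hε)
  obtain ⟨q, ⟨hq, hqε⟩, hmin⟩ := (hfin.inter_of_left {q | x < (q : ℝ)}).exists_minimalFor
    (fun q : Qpos => (q : ℝ)) _ ⟨q₀, hclose q₀ h1 h2.le, h1⟩
  obtain ⟨r, hr1, hr2⟩ := exists_Qpos_between hx hqε
  have hqx : |(q : ℝ) - x| ≤ ε := hq
  have hqx := (abs_le.1 hqx).2
  have := hmin (j := r) ⟨hclose r hr1 (by linarith), hr1⟩ hr2.le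
  linarith

/-- Needle lengths: every positive rational once, together with two further needles of
length `x`. -/
def lengthsWithPair (x : ℝ) : Qpos ⊕ Bool → ℝ :=
  Sum.elim (fun q => (q : ℝ)) fun _ => x

lemma lengthsWithPair_pos {x : ℝ} (hx : 0 < x) (a : Qpos ⊕ Bool) : 0 < lengthsWithPair x a := by
  rcases a with q | _
  · exact q.2.1
  · exact hx

lemma lengthsWithPair_eq_of_ne {x : ℝ} {a b : Qpos ⊕ Bool} (hab : a ≠ b)
    (h : lengthsWithPair x a = lengthsWithPair x b) : lengthsWithPair x a = x := by
  rcases a with p | _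
  · rcases b with q | _
    · exact absurd (congrArg Sum.inl (Subtype.ext h)) hab
    · exact h
  · rfl

lemma exists_equiv_Qpos_near {x ε : ℝ} (hx : 0 < x) (hε : 0 < ε) :
    ∃ e : Qpos ⊕ Bool ≃ Qpos, ∀ a, |lengthsWithPair x a - e a| ≤ ε := by
  have := infinite_Qpos_near hx.le (half_pos hε)
  obtain ⟨e, hl, hr⟩ := exists_sum_equiv_of_infinite (β := Bool) {q : Qpos | |(q : ℝ) - x| ≤ ε / 2}
  refine ⟨e, fun a => ?_⟩
  rcases a with q | b
  · change |(q : ℝ) - e (Sum.inl q)| ≤ ε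
    rcases hl q with h | ⟨(h1 : |(q : ℝ) - x| ≤ _), (h2 : |(e (Sum.inl q) : ℝ) - x| ≤ _)⟩
    · simpa [h] using hε.le
    · have h1 := abs_le.1 h1
      have h2 := abs_le.1 h2
      exact abs_le.2 ⟨by linarith, by linarith⟩
  · have h : |(e (Sum.inr b) : ℝ) - x| ≤ _ := hr b
    have h := abs_le.1 h
    exact abs_le.2 ⟨by change _ ≤ x - _; linarith, by change x - _ ≤ _; linarith⟩

lemma eq_of_isometricM_lengthsWithPair {x y : ℝ} (hx : 0 < x) (hy : 0 < y)
    (h : IsometricM (hedgehog _ (lengthsWithPair_pos hx)) (hedgehog _ (lengthsWithPair_pos hy))) :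
    x = y := by
  obtain ⟨F, hF⟩ := h
  change ∀ a b, hedgehogDist (lengthsWithPair y) (F a) (F b) =
    hedgehogDist (lengthsWithPair x) a b at hF
  have h0 : F none = none := hedgehog_isometry_center (lengthsWithPair_pos hy)
    (fun ε hε => (exists_Qpos_between le_rfl hε).imp' Sum.inl fun _ h => h.2) F hF
  have hneedle : ∀ a, ∃ b, F (some a) = some b ∧ lengthsWithPair y b = lengthsWithPair x a := by
    intro a
    rcases hb : F (some a) with _ | b
    · simpa using F.injective (hb.trans h0.symm)
    · have := hF none (some a)
      rw [h0, hb] at this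
      exact ⟨b, rfl, this⟩
  obtain ⟨b, hb, hbx⟩ := hneedle (Sum.inr true)
  obtain ⟨c, hc, hcx⟩ := hneedle (Sum.inr false)
  have hbc : b ≠ c := by
    rintro rfl
    simpa using F.injective (hb.trans hc.symm)
  exact hbx.symm.trans (lengthsWithPair_eq_of_ne hbc (hbx.trans hcx.symm))

/-- There is a family of pairwise non-isometric nonempty complete metric spaces,
indexed by the reals, all at zero Gromov–Hausdorff distance from the hedgehog over
the positive rationals. -/
theorem continuum_many_spaces_zero_dist_from_Qpos :
    ∃ (Y : ℝ → Type) (mY : ∀ t, MetricSpace (Y t)),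
      (∀ t, Nonempty (Y t)) ∧
      (∀ t, @CompleteSpace (Y t) (mY t).toPseudoMetricSpace.toUniformSpace) ∧
      (∀ s t : ℝ, s ≠ t → ¬ IsometricM (mY s) (mY t)) ∧
      (∀ t, @GHDist (Y t) (Option ↥Qpos) (mY t) (hedgehogSet Qpos Qpos_subset) = 0) := by
  refine ⟨fun _ => Option (Qpos ⊕ Bool),
    fun t => hedgehog (lengthsWithPair (Real.exp t)) (lengthsWithPair_pos (Real.exp_pos t)),
    fun _ => ⟨none⟩, fun t => completeSpace_hedgehog _ _, fun s t hst h => ?_, fun t => ?_⟩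
  · exact hst (Real.exp_injective (eq_of_isometricM_lengthsWithPair (Real.exp_pos s) (Real.exp_pos t) h))
  · exact GHDist_hedgehog_eq_zero _ _ _ _ fun ε hε => exists_equiv_Qpos_near (Real.exp_pos t) hε
end

section
/- Let H be a subgroup of the multiplicative group of positive real numbers. Then dGH(Ĥ, R̂₊) = 0 if and only if the cardinality of H equals the cardinality of the continuum, where R̂₊ denotes the hedgehog over (0,∞). -/
set_option linter.unusedVariables false
set_option linter.unreachableTactic false
set_option linter.unusedTactic false

open scoped ENNReal

open Cardinal in
/-- An additive subgroup of the reals of cardinality continuum meets every nonempty open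
interval in continuum many points. -/
theorem AddSubgroup.continuum_le_mk_inter_Ioo (G : AddSubgroup ℝ) (hG : #G = 𝔠)
    {p q : ℝ} (hpq : p < q) : 𝔠 ≤ #↥((G : Set ℝ) ∩ Set.Ioo p q) := by
  have hdense : Dense (G : Set ℝ) := by
    rcases G.dense_or_cyclic with h | ⟨a, rfl⟩
    · exact h
    · have hc : #↥(AddSubgroup.closure ({a} : Set ℝ)) ≤ ℵ₀ := by
        rw [← AddSubgroup.zmultiples_eq_closure]
        have : (AddSubgroup.zmultiples a : Set ℝ).Countable := Set.countable_range _
        exact this.le_aleph0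
      exact absurd (hG ▸ hc) (not_le.2 aleph0_lt_continuum)
  obtain ⟨D, hDG, hDc, hD⟩ := hdense.exists_countable_dense_subset
  have hex : ∀ g : G, ∃ d : D, (g : ℝ) - d ∈ (G : Set ℝ) ∩ Set.Ioo p q := by
    intro g
    obtain ⟨d, hd, h1, h2⟩ := hD.exists_between (show (g : ℝ) - q < g - p by linarith)
    exact ⟨⟨d, hd⟩, G.sub_mem g.2 (hDG hd), by dsimp only; linarith, by dsimp only; linarith⟩
  choose d hd using hex
  have hinj : Function.Injective
      (fun g : G => ((d g, ⟨g - d g, hd g⟩) : D × ↥((G : Set ℝ) ∩ Set.Ioo p q))) := by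
    intro g g' h
    simp only [Prod.mk.injEq, Subtype.mk.injEq] at h
    obtain ⟨h1, h2⟩ := h
    rw [h1] at h2
    exact Subtype.ext (by linarith)
  have hle := mk_le_of_injective hinj
  rw [hG, mk_prod, lift_id, lift_id] at hle
  rcases le_max_iff.1 (hle.trans (mul_le_max _ _)) with h | h
  · rcases le_max_iff.1 h with h | h
    · exact absurd (h.trans hDc.le_aleph0) (not_le.2 aleph0_lt_continuum)
    · exact h
  · exact absurd h (not_le.2 aleph0_lt_continuum)

open Cardinal in
/-- A multiplicative subgroup of the positive reals of cardinality continuum meets every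
nonempty open interval of positive reals in continuum many points. -/
theorem continuum_le_mk_inter_Ioo_of_mul_closed {H : Set ℝ} (hpos : H ⊆ Set.Ioi 0)
    (hone : (1 : ℝ) ∈ H) (hmul : ∀ a ∈ H, ∀ b ∈ H, a * b ∈ H)
    (hinv : ∀ a ∈ H, a⁻¹ ∈ H) (hH : #H = 𝔠) {a b : ℝ} (ha : 0 ≤ a) (hab : a < b) :
    𝔠 ≤ #↥(H ∩ Set.Ioo a b) := by
  obtain ⟨c, hac, hcb⟩ := exists_between hab
  have hc : 0 < c := ha.trans_lt hac
  let G : AddSubgroup ℝ :=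
    { carrier := {t | Real.exp t ∈ H}
      zero_mem' := by simpa using hone
      add_mem' := fun {x y} hx hy => by
        simpa [Real.exp_add] using hmul _ hx _ hy
      neg_mem' := fun {x} hx => by
        simpa [Real.exp_neg] using hinv _ hx }
  have hG : #G = 𝔠 := by
    rw [← hH]
    exact mk_congr
      { toFun := fun t => ⟨Real.exp t, t.2⟩
        invFun := fun x => ⟨Real.log x, by
          change Real.exp (Real.log x) ∈ H
          rw [Real.exp_log (hpos x.2)]
          exact x.2⟩
        left_inv := fun t => by simp
        right_inv := fun x => Subtype.ext (Real.exp_log (hpos x.2)) }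
  refine (G.continuum_le_mk_inter_Ioo hG (Real.log_lt_log hc hcb)).trans ?_
  refine mk_le_of_injective (f := fun t => ⟨Real.exp t, t.2.1,
    hac.trans ((Real.log_lt_iff_lt_exp hc).1 t.2.2.1),
    (Real.lt_log_iff_exp_lt (hc.trans hcb)).1 t.2.2.2⟩) ?_
  intro s t h
  exact Subtype.ext (Real.exp_injective (congrArg Subtype.val h))

open Cardinal in
/-- A set of positive reals meeting every nonempty open interval in continuum many points can be
matched with any other such set by a bijection moving points arbitrarily little. -/
theorem exists_equiv_abs_sub_le_s18 {A B : Set ℝ} (hA : A ⊆ Set.Ioi 0) (hB : B ⊆ Set.Ioi 0)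
    (hAc : ∀ a b : ℝ, 0 ≤ a → a < b → 𝔠 ≤ #↥(A ∩ Set.Ioo a b))
    (hBc : ∀ a b : ℝ, 0 ≤ a → a < b → 𝔠 ≤ #↥(B ∩ Set.Ioo a b))
    {δ : ℝ} (hδ : 0 < δ) : ∃ e : A ≃ B, ∀ x : A, |(x : ℝ) - e x| ≤ δ := by
  have key : ∀ X : Set ℝ, (∀ a b : ℝ, 0 ≤ a → a < b → 𝔠 ≤ #↥(X ∩ Set.Ioo a b)) →
      ∀ n : ℕ, #{x : X // ⌊(x : ℝ) / δ⌋₊ = n} = 𝔠 := by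
    intro X hX n
    apply le_antisymm
    · rw [← mk_real]
      exact mk_le_of_injective (Subtype.val_injective.comp Subtype.val_injective)
    · refine (hX (n * δ) ((n + 1) * δ) (by positivity) (by linarith)).trans ?_
      refine mk_le_of_injective (f := fun x => ⟨⟨x, x.2.1⟩, ?_⟩) ?_
      · have h1 := x.2.2.1
        have h2 := x.2.2.2
        have hn : (n : ℝ) ≤ x / δ := (le_div_iff₀ hδ).2 h1.le
        exact (Nat.floor_eq_iff (n.cast_nonneg.trans hn)).2 ⟨hn, (div_lt_iff₀ hδ).2 h2⟩
      · intro x y h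
        simp only [Subtype.mk.injEq] at h
        exact Subtype.ext h
  have hE : ∀ n : ℕ, Nonempty ({x : A // ⌊(x : ℝ) / δ⌋₊ = n} ≃ {x : B // ⌊(x : ℝ) / δ⌋₊ = n}) :=
    fun n => Cardinal.eq.1 ((key A hAc n).trans (key B hBc n).symm)
  let E := fun n => (hE n).some
  let e : A ≃ B := Equiv.ofFiberEquiv (f := fun x : A => ⌊(x : ℝ) / δ⌋₊)
    (g := fun x : B => ⌊(x : ℝ) / δ⌋₊) E
  refine ⟨e, fun x => ?_⟩
  have hfl : ⌊(e x : ℝ) / δ⌋₊ = ⌊(x : ℝ) / δ⌋₊ :=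
    Equiv.ofFiberEquiv_map (f := fun x : A => ⌊(x : ℝ) / δ⌋₊)
      (g := fun x : B => ⌊(x : ℝ) / δ⌋₊) E x
  obtain ⟨h1, h2⟩ := (Nat.floor_eq_iff (div_nonneg (le_of_lt (hA x.2)) hδ.le)).1 rfl
  obtain ⟨h3, h4⟩ := (Nat.floor_eq_iff (div_nonneg (le_of_lt (hB (e x).2)) hδ.le)).1 hfl
  rw [le_div_iff₀ hδ] at h1 h3
  rw [div_lt_iff₀ hδ] at h2 h4
  rw [abs_le]
  constructor <;> nlinarith

/-- Bijective needles of nearby lengths give a correspondence of small distortion. -/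
theorem GHDist_hedgehogSet_le {A B : Set ℝ} (hA : A ⊆ Set.Ioi 0) (hB : B ⊆ Set.Ioi 0)
    {δ : ℝ} (e : A ≃ B) (he : ∀ x : A, |(x : ℝ) - e x| ≤ δ) (hδ : 0 ≤ δ) :
    @GHDist (Option A) (Option B) (hedgehogSet A hA) (hedgehogSet B hB) ≤
      ENNReal.ofReal (2 * δ) := by
  let := hedgehogSet A hA
  let := hedgehogSet B hB
  let R : Set (Option A × Option B) := {p | p.2 = p.1.map e}
  have hR : IsCorrespondence R := by
    refine ⟨fun x => ⟨x.map e, rfl⟩, fun y => ⟨y.map e.symm, ?_⟩⟩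
    cases y <;> simp [R]
  have hdis : distortion R ≤ ENNReal.ofReal (2 * δ) := by
    refine iSup₂_le fun p hp => iSup₂_le fun q hq => ENNReal.ofReal_le_ofReal ?_
    obtain ⟨x, y⟩ := p
    obtain ⟨x', y'⟩ := q
    obtain rfl : y = x.map e := hp
    obtain rfl : y' = x'.map e := hq
    change |hedgehogDist (fun a : A => (a : ℝ)) x x' -
      hedgehogDist (fun b : B => (b : ℝ)) (x.map e) (x'.map e)| ≤ 2 * δ
    rcases x with _ | x <;> rcases x' with _ | x' <;>
      simp only [hedgehogDist, Option.map_none, Option.map_some, e.apply_eq_iff_eq]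
    · simpa using hδ
    · linarith [he x']
    · linarith [he x]
    · split_ifs
      · simpa using hδ
      · have h1 := abs_le.1 (he x)
        have h2 := abs_le.1 (he x')
        exact abs_le.2 ⟨by linarith [h1.1, h2.1], by linarith [h1.2, h2.2]⟩
  exact ENNReal.half_le_self.trans ((iInf_le _ ⟨R, hR⟩).trans hdis)

open Cardinal in
/-- A hedgehog at zero distance from the hedgehog over the positive reals has at least
continuum many needles. -/
theorem continuum_le_mk_of_GHDist_eq_zero {A : Set ℝ} (hA : A ⊆ Set.Ioi 0)
    (h : @GHDist (Option A) (Option ↥(Set.Ioi (0 : ℝ)))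
      (hedgehogSet A hA) (hedgehogSet (Set.Ioi 0) subset_rfl) = 0) : 𝔠 ≤ #A := by
  let := hedgehogSet A hA
  let := hedgehogSet (Set.Ioi 0) subset_rfl
  have h0 : (⨅ R : {R : Set (Option A × Option ↥(Set.Ioi (0 : ℝ))) // IsCorrespondence R},
      distortion R.1) = 0 := by
    simpa using ENNReal.div_eq_zero_iff.1 h
  obtain ⟨⟨R, hR⟩, hlt⟩ := iInf_lt_iff.1 (h0.trans_lt one_pos)
  choose x hx using fun y : Set.Ioi (1 : ℝ) => hR.2 (some ⟨y, Set.mem_Ioi.2 (one_pos.trans y.2)⟩)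
  have hinj : Function.Injective x := by
    intro y y' hyy
    by_contra hne
    have hle : ENNReal.ofReal |dist (x y) (x y') -
        dist (some (⟨y, Set.mem_Ioi.2 (one_pos.trans y.2)⟩ : Set.Ioi (0 : ℝ))) (some ⟨y', Set.mem_Ioi.2 (one_pos.trans y'.2)⟩)| <
        1 :=
      (le_iSup₂_of_le (f := fun p (_ : p ∈ R) => ⨆ q ∈ R,
        ENNReal.ofReal |dist p.1 q.1 - dist p.2 q.2|) _ (hx y)
        (le_iSup₂_of_le _ (hx y') le_rfl)).trans_lt hlt
    have hd : dist (some (⟨y, Set.mem_Ioi.2 (one_pos.trans y.2)⟩ : Set.Ioi (0 : ℝ)))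
        (some ⟨y', Set.mem_Ioi.2 (one_pos.trans y'.2)⟩) = y + y' := by
      change hedgehogDist (fun b : Set.Ioi (0 : ℝ) => (b : ℝ)) _ _ = _
      simp [hedgehogDist, Subtype.val_inj, hne]
    have h1 : (1 : ℝ) < y := y.2
    have h2 : (1 : ℝ) < y' := y'.2
    rw [hyy, dist_self, hd, ENNReal.ofReal_lt_one, zero_sub, abs_neg,
      abs_of_pos (by linarith)] at hle
    linarith
  have hc := mk_le_of_injective hinj
  rw [mk_Ioi_real, mk_option] at hc
  rcases lt_or_ge #A ℵ₀ with hf | hf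
  · exact absurd (hc.trans_lt (add_lt_aleph0 hf one_lt_aleph0))
      (not_lt.2 aleph0_le_continuum)
  · rwa [add_one_eq hf] at hc

/-- For a subgroup `H` of the multiplicative group of positive reals, the hedgehog
over `H` is at zero Gromov–Hausdorff distance from the hedgehog over `(0,∞)` iff
`H` has the cardinality of the continuum. -/
theorem hedgehog_subgroup_zero_dist_from_Rpos_iff (H : Set ℝ) (hpos : H ⊆ Set.Ioi 0)
    (hone : (1 : ℝ) ∈ H) (hmul : ∀ a ∈ H, ∀ b ∈ H, a * b ∈ H)
    (hinv : ∀ a ∈ H, a⁻¹ ∈ H) :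
    @GHDist (Option ↥H) (Option ↥(Set.Ioi (0 : ℝ)))
        (hedgehogSet H hpos) (hedgehogSet (Set.Ioi 0) subset_rfl) = 0 ↔
      Cardinal.mk H = Cardinal.continuum := by
  constructor
  · intro h
    exact le_antisymm ((Cardinal.mk_set_le H).trans_eq Cardinal.mk_real)
      (continuum_le_mk_of_GHDist_eq_zero hpos h)
  · intro hH
    refine le_antisymm (le_of_forall_gt fun ε hε => ?_) zero_le
    obtain ⟨r, hr, hrε⟩ := ENNReal.lt_iff_exists_nnreal_btwn.1 hε
    have hr0 : 0 < (r : ℝ) := by exact_mod_cast hr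
    obtain ⟨e, he⟩ := exists_equiv_abs_sub_le_s18 hpos subset_rfl
      (fun a b => continuum_le_mk_inter_Ioo_of_mul_closed hpos hone hmul hinv hH)
      (fun a b => continuum_le_mk_inter_Ioo_of_mul_closed subset_rfl (Set.mem_Ioi.2 one_pos)
        (fun x hx y hy => Set.mem_Ioi.2 (mul_pos hx hy))
        (fun x hx => Set.mem_Ioi.2 (inv_pos.2 hx)) (Cardinal.mk_Ioi_real 0)) (half_pos hr0)
    refine (GHDist_hedgehogSet_le hpos subset_rfl e he (half_pos hr0).le).trans_lt ?_
    rwa [mul_div_cancel₀ _ two_ne_zero, ENNReal.ofReal_coe_nnreal]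
end
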